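/- arXiv:1610.00140 — 7 statements merged into one kernel-verified Lean document; each statement's English description precedes it below -/
import Mathlib

section
/- For all integers n and d with 2 ≤ d ≤ n, β^d(n) ≤ C(⌈2(n-1)/(d-1)⌉, 2) + ⌈(n-1)/(d-1)⌉·(d+1), where C(m,2) denotes the binomial coefficient 'm choose 2'. -/
open Finset

/-- Two vectors are *trivially orthogonal* if in every coordinate at least one of them is zero. -/
def TrivOrth {n : ℕ} (A B : Fin n → ℤ) : Prop := ∀ i, A i = 0 ∨ B i = 0

/-- Two vectors are *non-trivially orthogonal* if they are orthogonal but not trivially so. -/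
def NonTrivOrth {n : ℕ} (A B : Fin n → ℤ) : Prop :=
  (∑ i, A i * B i) = 0 ∧ ¬ TrivOrth A B

/-- `V` is a `{-1,0,1}`-vector with exactly `d` nonzero entries. -/
def IsSignVec {n : ℕ} (d : ℕ) (V : Fin n → ℤ) : Prop :=
  (∀ i, V i = -1 ∨ V i = 0 ∨ V i = 1) ∧
    (Finset.univ.filter fun i => V i ≠ 0).card = d

/-- `A` is a point of the Hamming cube `{0,1}ⁿ`. -/
def IsCubePt {n : ℕ} (A : Fin n → ℤ) : Prop := ∀ i, A i = 0 ∨ A i = 1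

/-- A point of the Hamming cube is *trivial* if it is the zero vector, a standard unit
vector, or (when `d` is odd) the all-ones vector. -/
def TrivialPt {n : ℕ} (d : ℕ) (A : Fin n → ℤ) : Prop :=
  (∀ i, A i = 0) ∨ (∃ j, ∀ i, A i = if i = j then 1 else 0) ∨ (Odd d ∧ ∀ i, A i = 1)

/-- `𝒱` is a family of `{-1,0,1}`-vectors, each with exactly `d` nonzero entries, such that
every non-trivial point of the Hamming cube is non-trivially orthogonal to some member. -/
def IsCovering (n d : ℕ) (𝒱 : Finset (Fin n → ℤ)) : Prop :=
  (∀ V ∈ 𝒱, IsSignVec d V) ∧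
    ∀ A : Fin n → ℤ, IsCubePt A → ¬ TrivialPt d A → ∃ V ∈ 𝒱, NonTrivOrth A V

/-- `β^d(n)`: the minimum cardinality of such a covering family. -/
noncomputable def beta (n d : ℕ) : ℕ :=
  sInf {t | ∃ 𝒱 : Finset (Fin n → ℤ), 𝒱.card = t ∧ IsCovering n d 𝒱}

/-- The first row of a circulant sign matrix of order `d + 1`: a zero, followed by
`⌈d/2⌉` plus ones and `⌊d/2⌋` minus ones. -/
def circSign (d j : ℕ) : ℤ := if j = 0 then 0 else if j ≤ (d + 1) / 2 then 1 else -1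

lemma sum_range_circSign (d m : ℕ) :
    ∑ j ∈ range (m + 1), circSign d j =
      if m ≤ (d + 1) / 2 then (m : ℤ) else 2 * ((d + 1) / 2 : ℕ) - m := by
  induction m with
  | zero => simp [circSign]
  | succ m ih =>
    rw [sum_range_succ, ih]
    unfold circSign
    generalize (d + 1) / 2 = h
    push_cast
    split_ifs <;> omega

lemma sum_circSign (d : ℕ) :
    ∑ j : ZMod (d + 1), circSign d j.val = 2 * ((d + 1) / 2 : ℕ) - d := by
  have h : ∑ j : ZMod (d + 1), circSign d j.val = ∑ j ∈ range (d + 1), circSign d j :=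
    Fin.sum_univ_eq_sum_range (circSign d) (d + 1)
  rw [h, sum_range_circSign]
  split_ifs <;> omega

lemma circSign_sub_one {d : ℕ} (hd : 2 ≤ d) (j : ZMod (d + 1)) :
    circSign d (j - 1).val = circSign d j.val - (if j = 0 then 1 else 0)
      - (if j = 1 then 1 else 0) + (if j = (((d + 1) / 2 + 1 : ℕ) : ZMod (d + 1)) then 2 else 0) := by
  have h1 : (1 : ZMod (d + 1)).val = 1 := by
    have := ZMod.val_natCast_of_lt (n := d + 1) (a := 1) (by omega)
    simpa using this
  have hh : (((d + 1) / 2 + 1 : ℕ) : ZMod (d + 1)).val = (d + 1) / 2 + 1 :=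
    ZMod.val_natCast_of_lt (by omega)
  have e0 : j = 0 ↔ j.val = 0 := (ZMod.val_eq_zero j).symm
  have e1 : j = 1 ↔ j.val = 1 := by
    rw [← (ZMod.val_injective (d + 1)).eq_iff, h1]
  have e2 : j = (((d + 1) / 2 + 1 : ℕ) : ZMod (d + 1)) ↔ j.val = (d + 1) / 2 + 1 := by
    rw [← (ZMod.val_injective (d + 1)).eq_iff, hh]
  have hv : (j - 1).val = if j.val = 0 then d else j.val - 1 := by
    split_ifs with h
    · rw [e0.2 h, zero_sub, ZMod.val_neg_one]
    · rw [ZMod.val_sub (by omega), h1]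
  have hlt := ZMod.val_lt j
  simp only [e0, e1, e2, hv]
  unfold circSign
  split_ifs <;> omega

/-- Every nontrivial `0/1`-vector of length `d + 1` is orthogonal to some row of the circulant
sign matrix. -/
lemma exists_circSign_orthogonal {d : ℕ} (hd : 2 ≤ d) (a : ZMod (d + 1) → ℤ)
    (ha : ∀ i, a i = 0 ∨ a i = 1) (hodd : Odd d → ∃ i, a i = 0) :
    ∃ z, ∑ i, a i * circSign d (i - z).val = 0 := by
  by_contra! hne
  set g : ZMod (d + 1) → ℤ := fun z => ∑ i, a i * circSign d (i - z).val with hg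
  have hstep : ∀ z, g (z + 1) =
      g z - a z - a (z + 1) + 2 * a (z + (((d + 1) / 2 + 1 : ℕ) : ZMod (d + 1))) := by
    intro z
    have : ∀ i, a i * circSign d (i - (z + 1)).val = a i * circSign d (i - z).val
        - (if i = z then a i else 0) - (if i = z + 1 then a i else 0)
        + (if i = z + (((d + 1) / 2 + 1 : ℕ) : ZMod (d + 1)) then 2 * a i else 0) := by
      intro i
      rw [← sub_sub, circSign_sub_one hd (i - z)]
      simp only [sub_eq_iff_eq_add', add_zero]
      split_ifs <;> ring
    simp only [hg, this, sum_add_distrib, sum_sub_distrib, sum_ite_eq', mem_univ, if_true]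
  have hpar : ∀ z, ∃ t, g z = (∑ i, a i) - a z - 2 * t := by
    intro z
    refine ⟨∑ i, if (d + 1) / 2 < (i - z).val then a i else 0, ?_⟩
    have : ∀ i, a i * circSign d (i - z).val = a i - (if i = z then a i else 0)
        - 2 * (if (d + 1) / 2 < (i - z).val then a i else 0) := by
      intro i
      have e0 : i = z ↔ (i - z).val = 0 := by rw [ZMod.val_eq_zero, sub_eq_zero]
      simp only [e0]
      unfold circSign
      split_ifs <;> omega
    simp only [hg, this, sum_sub_distrib, sum_ite_eq', mem_univ, if_true, mul_sum]
  have hsum : ∑ z, g z = (∑ i, a i) * (2 * ((d + 1) / 2 : ℕ) - d) := by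
    simp only [hg]
    rw [sum_comm, sum_mul]
    refine sum_congr rfl fun i _ => ?_
    rw [← mul_sum, ← sum_circSign]
    congr 1
    exact Equiv.sum_comp (Equiv.subLeft i) fun j => circSign d j.val
  have hnn : 0 ≤ ∑ i, a i := sum_nonneg fun i _ => by rcases ha i with h | h <;> omega
  have hlow : 0 ≤ ∑ z, g z := hsum ▸ mul_nonneg hnn (by omega)
  have hcard : ∑ _z : ZMod (d + 1), (1 : ℤ) = d + 1 := by simp [ZMod.card]
  have hupp : ∑ z, g z < d + 1 := by
    rw [hsum]
    rcases Nat.even_or_odd d with he | ho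
    · have : (2 * ((d + 1) / 2 : ℕ) - d : ℤ) = 0 := by
        obtain ⟨k, rfl⟩ := he; omega
      rw [this]; omega
    · have : (2 * ((d + 1) / 2 : ℕ) - d : ℤ) = 1 := by
        obtain ⟨k, rfl⟩ := ho; omega
      rw [this, mul_one, ← hcard]
      obtain ⟨i, hi⟩ := hodd ho
      exact sum_lt_sum (fun i _ => by rcases ha i with h | h <;> omega)
        ⟨i, mem_univ i, by omega⟩
  have hnotneg : ¬ ∀ z, g z < 0 := fun h =>
    absurd hlow (not_le.2 (sum_neg (fun z _ => h z) univ_nonempty))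
  have hnotpos : ¬ ∀ z, 0 < g z := fun h =>
    absurd hupp (not_lt.2 (hcard ▸ sum_le_sum fun z _ => h z))
  have hrot : ∀ P : ZMod (d + 1) → Prop, (∀ z, P z → P (z + 1)) → ∀ z, P z → ∀ w, P w := by
    intro P hP z hz w
    have : ∀ k : ℕ, P (z + k) := by
      intro k
      induction k with
      | zero => simpa using hz
      | succ k ih => simpa [add_assoc] using hP _ ih
    simpa using this (w - z).val
  rcases Int.even_or_odd (∑ i, a i) with ⟨s, hs⟩ | ⟨s, hs⟩
  · have hP : ∀ z, g z < 0 → g (z + 1) < 0 := by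
      intro z hz
      obtain ⟨t, ht⟩ := hpar z
      have h1 := hne (z + 1)
      have h2 := hstep z
      have h3 := ha z
      have h4 := ha (z + 1)
      have h5 := ha (z + (((d + 1) / 2 + 1 : ℕ) : ZMod (d + 1)))
      change g (z + 1) ≠ 0 at h1
      omega
    refine hnotpos fun z => ?_
    by_contra hz
    have h1 : g z ≠ 0 := hne z
    exact hnotneg (hrot _ hP z (by omega))
  · have hP : ∀ z, 0 < g z → 0 < g (z + 1) := by
      intro z hz
      obtain ⟨t, ht⟩ := hpar z
      have h1 := hne (z + 1)
      have h2 := hstep z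
      have h3 := ha z
      have h4 := ha (z + 1)
      have h5 := ha (z + (((d + 1) / 2 + 1 : ℕ) : ZMod (d + 1)))
      change g (z + 1) ≠ 0 at h1
      omega
    refine hnotneg fun z => ?_
    by_contra hz
    have h1 : g z ≠ 0 := hne z
    exact hnotpos (hrot _ hP z (by omega))

/-- On any `d + 1` coordinates, `d + 1` sign vectors suffice to cover all cube points with at
least two ones there, except possibly (for odd `d`) those that are all ones there. -/
lemma exists_window_covering {n d : ℕ} (hd : 2 ≤ d) (W : Finset (Fin n)) (hW : W.card = d + 1) :
    ∃ v : ZMod (d + 1) → Fin n → ℤ, (∀ z, IsSignVec d (v z)) ∧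
      ∀ A : Fin n → ℤ, IsCubePt A → (∃ p ∈ W, ∃ q ∈ W, p ≠ q ∧ A p = 1 ∧ A q = 1) →
        (Odd d → ∃ r ∈ W, A r = 0) → ∃ z, NonTrivOrth A (v z) := by
  let f : ZMod (d + 1) ≃ W :=
    Fintype.equivOfCardEq (by rw [ZMod.card, Fintype.card_coe, hW])
  let v : ZMod (d + 1) → Fin n → ℤ := fun z e =>
    if h : e ∈ W then circSign d (f.symm ⟨e, h⟩ - z).val else 0
  have hvf : ∀ z i, v z (f i) = circSign d (i - z).val := by
    intro z i
    simp [v]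
  have hc : ∀ j : ZMod (d + 1), circSign d j.val = 0 ↔ j = 0 := by
    intro j
    rw [← ZMod.val_eq_zero]
    unfold circSign
    split_ifs <;> simp_all
  have hvne : ∀ z, ∀ e, v z e ≠ 0 ↔ e ∈ W.erase (f z : Fin n) := by
    intro z e
    by_cases h : e ∈ W
    · obtain ⟨i, hi⟩ := f.surjective ⟨e, h⟩
      have hi' : e = f i := by rw [hi]
      rw [hi', hvf, Ne, hc, sub_eq_zero, mem_erase, ← hi']
      rw [hi', Ne, Subtype.coe_inj, f.injective.eq_iff]
      simp
    · simp [v, h]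
  refine ⟨v, fun z => ⟨fun e => ?_, ?_⟩, fun A hA ⟨p, hp, q, hq, hpq, hAp, hAq⟩ hodd => ?_⟩
  · by_cases h : e ∈ W
    · simp only [v, h, dif_pos]
      unfold circSign
      split_ifs <;> simp
    · simp [v, h]
  · have : (univ.filter fun e => v z e ≠ 0) = W.erase (f z : Fin n) := by
      ext e; simp only [mem_filter, mem_univ, true_and, hvne]
    rw [this, card_erase_of_mem (f z).2, hW]; rfl
  · obtain ⟨z, hz⟩ := exists_circSign_orthogonal hd (fun i => A (f i)) (fun i => hA _)
      (fun ho => by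
        obtain ⟨r, hr, hr0⟩ := hodd ho
        exact ⟨f.symm ⟨r, hr⟩, by simpa using hr0⟩)
    refine ⟨z, ?_, fun htriv => ?_⟩
    · rw [← hz]
      have h1 : ∑ e, A e * v z e = ∑ e ∈ W, A e * v z e :=
        (sum_subset (subset_univ W) fun e _ he => by simp [v, he]).symm
      rw [h1, ← sum_coe_sort W fun e => A e * v z e, ← Equiv.sum_comp f]
      simp only [hvf]
    · have key : ∀ e ∈ W, A e = 1 → e = f z := by
        intro e he h1
        by_contra hne
        rcases htriv e with h | h
        · omega
        · exact (hvne z e).2 (mem_erase.2 ⟨hne, he⟩) h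
      exact hpq ((key p hp hAp).trans (key q hq hAq).symm)

/-- If `n > d`, the coordinates can be covered by few windows of size `d + 1` sharing two
coordinates `x` and `y`. -/
lemma exists_windows {n d : ℕ} (hd : 2 ≤ d) (hdn : d < n) :
    ∃ W : ℕ → Finset (Fin n), ∀ k, (W k).card = d + 1 ∧
      ∀ e : Fin n, (e.val / (d - 1) = k ∨ n - 2 ≤ e.val) → e ∈ W k := by
  have : ∀ k, ∃ W : Finset (Fin n), W.card = d + 1 ∧
      ∀ e : Fin n, (e.val / (d - 1) = k ∨ n - 2 ≤ e.val) → e ∈ W := by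
    intro k
    let B : Finset (Fin n) := univ.filter fun e => e.val / (d - 1) = k
    let E : Finset (Fin n) := univ.filter fun e => n - 2 ≤ e.val
    have hB : B.card ≤ d - 1 := by
      rw [← card_range (d - 1)]
      refine card_le_card_of_injOn (fun e => e.val % (d - 1)) (fun e _ => ?_) ?_
      · simpa using Nat.mod_lt _ (by omega)
      · intro e he e' he' h
        have h1 : e.val / (d - 1) = k := by simpa [B] using he
        have h2 : e'.val / (d - 1) = k := by simpa [B] using he'
        apply Fin.ext
        rw [← Nat.div_add_mod e.val (d - 1), ← Nat.div_add_mod e'.val (d - 1), h1, h2]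
        simpa using h
    have hE : E.card ≤ 2 := by
      have : 2 = (Ico (n - 2) n).card := by rw [Nat.card_Ico]; omega
      rw [this]
      refine card_le_card_of_injOn (fun e => e.val) (fun e he => ?_) Fin.val_injective.injOn
      simpa [E] using he
    obtain ⟨W, h1, -, h2⟩ := exists_subsuperset_card_eq (subset_univ (B ∪ E))
      (n := d + 1) ((card_union_le B E).trans (by omega)) (by simpa using hdn)
    refine ⟨W, h2, fun e he => h1 ?_⟩
    simpa [B, E] using he
  choose W hW using this
  exact ⟨W, hW⟩

/-- Blocks of `d - 1` consecutive numbers are cut into two parts of size at most `d / 2`;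
`halfIndex d e` is the index of the part containing `e`. -/
def halfIndex (d e : ℕ) : ℕ := 2 * (e / (d - 1)) + e % (d - 1) / (d / 2)

lemma mod_div_half_le_one {d : ℕ} (hd : 2 ≤ d) (e : ℕ) : e % (d - 1) / (d / 2) ≤ 1 := by
  have h := Nat.mod_lt e (show 0 < d - 1 by omega)
  have : e % (d - 1) / (d / 2) < 2 := by
    rw [Nat.div_lt_iff_lt_mul (by omega)]; omega
  omega

lemma halfIndex_div_two {d : ℕ} (hd : 2 ≤ d) (e : ℕ) : halfIndex d e / 2 = e / (d - 1) := by
  have := mod_div_half_le_one hd e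
  unfold halfIndex
  generalize e % (d - 1) / (d / 2) = t at *
  generalize e / (d - 1) = s at *
  omega

lemma halfIndex_mul_le {d : ℕ} (hd : 2 ≤ d) (e : ℕ) : halfIndex d e * (d - 1) ≤ 2 * e := by
  have h1 := mod_div_half_le_one hd e
  have h2 : e % (d - 1) / (d / 2) * (d - 1) ≤ 2 * (e % (d - 1)) := by
    have h3 := Nat.div_mul_le_self (e % (d - 1)) (d / 2)
    generalize e % (d - 1) / (d / 2) = t at *
    interval_cases t <;> omega
  have h4 := Nat.div_add_mod e (d - 1)
  unfold halfIndex
  nlinarith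

lemma card_halfIndex_le {n d : ℕ} (hd : 2 ≤ d) (i : ℕ) :
    (univ.filter fun e : Fin n => halfIndex d e = i).card ≤ d / 2 := by
  rw [← card_range (d / 2)]
  refine card_le_card_of_injOn (fun e => e.val % (d - 1) % (d / 2)) (fun e _ => ?_) ?_
  · simpa using Nat.mod_lt _ (show 0 < d / 2 by omega)
  · intro e he e' he' h
    have h1 : halfIndex d e = i := by simpa using he
    have h2 : halfIndex d e' = i := by simpa using he'
    have h3 : e.val / (d - 1) = e'.val / (d - 1) := by
      rw [← halfIndex_div_two hd, ← halfIndex_div_two hd, h1, h2]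
    have h4 : e.val % (d - 1) / (d / 2) = e'.val % (d - 1) / (d / 2) := by
      unfold halfIndex at h1 h2
      omega
    have h5 : e.val % (d - 1) = e'.val % (d - 1) := by
      rw [← Nat.div_add_mod (e.val % (d - 1)) (d / 2),
        ← Nat.div_add_mod (e'.val % (d - 1)) (d / 2), h4]
      simpa using h
    apply Fin.ext
    rw [← Nat.div_add_mod e.val (d - 1), ← Nat.div_add_mod e'.val (d - 1), h3, h5]

lemma exists_pair_vector {n d : ℕ} (hd : 2 ≤ d) (W : ℕ → Finset (Fin n))
    (hW : ∀ k, (W k).card = d + 1 ∧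
      ∀ e : Fin n, (e.val / (d - 1) = k ∨ n - 2 ≤ e.val) → e ∈ W k) (i j : ℕ) :
    ∃ u : Fin n → ℤ, IsSignVec d u ∧ (∀ e : Fin n, halfIndex d e = i → u e = 1) ∧
      (∀ e : Fin n, halfIndex d e = j → i ≠ j → u e = -1) ∧
      ∀ e, u e ≠ 0 → e ∈ W (i / 2) ∪ W (j / 2) := by
  let H : ℕ → Finset (Fin n) := fun i => univ.filter fun e : Fin n => halfIndex d e = i
  have hHW : ∀ i, H i ⊆ W (i / 2) := by
    intro i e he
    have he : halfIndex d e = i := by simpa [H] using he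
    exact (hW _).2 e (Or.inl (by rw [← halfIndex_div_two hd, he]))
  have hHc : ∀ i, (H i).card ≤ d / 2 := card_halfIndex_le hd
  obtain ⟨S, h1, h2, h3⟩ := exists_subsuperset_card_eq (union_subset_union (hHW i) (hHW j))
    (n := d) ((card_union_le _ _).trans (by have := hHc i; have := hHc j; omega))
    (by have := card_le_card (subset_union_left (s₁ := W (i / 2)) (s₂ := W (j / 2)))
        have := (hW (i / 2)).1
        omega)
  have hS : ∀ e : Fin n, (halfIndex d e = i ∨ halfIndex d e = j) → e ∈ S := fun e he =>
    h1 (by simpa [H] using he)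
  refine ⟨fun e => if e ∈ S then if halfIndex d e = i then 1 else -1 else 0,
    ⟨fun e => ?_, ?_⟩, fun e he => ?_, fun e he hij => ?_, fun e he => ?_⟩
  · dsimp only
    split_ifs <;> simp
  · rw [← h3]
    congr 1
    ext e
    simp only [mem_filter, mem_univ, true_and]
    split_ifs <;> simp_all
  · simp [hS e (Or.inl he), he]
  · simp [hS e (Or.inr he), he, hij.symm]
  · refine h2 ?_
    by_contra h
    simp [h] at he

lemma exists_covering {n d : ℕ} (hd : 2 ≤ d) (hdn : d < n) {M m : ℕ}
    (hM : ∀ e < n - 1, halfIndex d e < M) (hm : ∀ e < n - 1, e / (d - 1) < m) :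
    ∃ 𝒱 : Finset (Fin n → ℤ), 𝒱.card ≤ M.choose 2 + m * (d + 1) ∧ IsCovering n d 𝒱 := by
  classical
  obtain ⟨W, hW⟩ := exists_windows hd hdn
  choose u hu1 hu2 hu3 hu4 using exists_pair_vector hd W hW
  choose v hv1 hv2 using fun k => exists_window_covering hd (W k) (hW k).1
  refine ⟨((range M).sigma fun j => range j).image (fun p => u p.2 p.1) ∪
    (range m ×ˢ (univ : Finset (ZMod (d + 1)))).image (fun p => v p.1 p.2), ?_, ?_, ?_⟩
  · refine (card_union_le _ _).trans (add_le_add (card_image_le.trans ?_) (card_image_le.trans ?_))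
    · simp [sum_range_id, Nat.choose_two_right]
    · simp [card_product, ZMod.card]
  · intro V hV
    rcases mem_union.1 hV with h | h
    · obtain ⟨p, -, rfl⟩ := mem_image.1 h
      exact hu1 _ _
    · obtain ⟨p, -, rfl⟩ := mem_image.1 h
      exact hv1 _ _
  intro A hA hnt
  by_contra! hcon
  let x : Fin n := ⟨n - 1, by omega⟩
  let y : Fin n := ⟨n - 2, by omega⟩
  have hx : ∀ k, x ∈ W k := fun k => (hW k).2 x (Or.inr (by simp only [x]; omega))
  have hy : ∀ k, y ∈ W k := fun k => (hW k).2 y (Or.inr le_rfl)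
  have hxy : x ≠ y := fun h => by
    have := congrArg Fin.val h
    simp only [x, y] at this
    omega
  have hself : ∀ e : Fin n, e ∈ W (e.val / (d - 1)) := fun e => (hW _).2 e (Or.inl rfl)
  have hlt_of_ne : ∀ e : Fin n, e ≠ x → e.val < n - 1 := fun e he => by
    have h1 : e.val ≠ n - 1 := fun h => he (Fin.ext h)
    have h2 := e.2
    omega
  have hwin : ∀ k < m, ∀ p ∈ W k, ∀ q ∈ W k, p ≠ q → A p = 1 → A q = 1 →
      Odd d ∧ ∀ r ∈ W k, A r = 1 := by
    intro k hk p hp q hq hpq h1 h2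
    by_contra! h
    obtain ⟨z, hz⟩ := hv2 k A hA ⟨p, hp, q, hq, hpq, h1, h2⟩ fun ho => by
      obtain ⟨r, hr, hr1⟩ := h ho
      exact ⟨r, hr, (hA r).resolve_right hr1⟩
    exact hcon _ (mem_union_right _ (mem_image.2
      ⟨(k, z), mem_product.2 ⟨mem_range.2 hk, mem_univ z⟩, rfl⟩)) hz
  have hnotboth : ¬ (A x = 1 ∧ A y = 1) := by
    rintro ⟨h1, h2⟩
    have h := fun k hk => hwin k hk x (hx k) y (hy k) hxy h1 h2
    refine hnt (Or.inr (Or.inr ⟨(h _ (hm 0 (by omega))).1, fun e => ?_⟩))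
    by_cases he : e = x
    · rw [he, h1]
    · exact (h _ (hm e (hlt_of_ne e he))).2 e (hself e)
  have hone : ∀ k < m, ∀ p ∈ W k, ∀ q ∈ W k, A p = 1 → A q = 1 → p = q := by
    intro k hk p hp q hq h1 h2
    by_contra hpq
    have h := (hwin k hk p hp q hq hpq h1 h2).2
    exact hnotboth ⟨h x (hx k), h y (hy k)⟩
  obtain ⟨a, ha⟩ : ∃ a, A a = 1 := by
    by_contra! h
    exact hnt (Or.inl fun i => (hA i).resolve_right (h i))
  obtain ⟨b, hb, hab⟩ : ∃ b, A b = 1 ∧ b ≠ a := by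
    by_contra! h
    refine hnt (Or.inr (Or.inl ⟨a, fun i => ?_⟩))
    split_ifs with hi
    · rw [hi, ha]
    · exact (hA i).resolve_right fun h' => hi (h i h')
  have hAx : ∀ e, A e = 1 → e.val < n - 1 := by
    intro e he
    by_contra hlt
    have hex : e = x := by
      by_contra h
      exact hlt (hlt_of_ne e h)
    subst hex
    obtain ⟨c, hc, hcx⟩ : ∃ c, A c = 1 ∧ c ≠ x := by
      by_cases hax : a = x
      · exact ⟨b, hb, hax ▸ hab⟩
      · exact ⟨a, ha, hax⟩
    exact hcx (hone _ (hm c (hlt_of_ne c hcx)) c (hself c) x (hx _) hc he)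
  have hneq : halfIndex d a ≠ halfIndex d b := fun h => hab
    (hone _ (hm b (hAx b hb)) b (hself b) a (by
      rw [← halfIndex_div_two hd, ← h, halfIndex_div_two hd]; exact hself a) hb ha)
  have main : ∀ a b : Fin n, A a = 1 → A b = 1 → halfIndex d a < halfIndex d b → False := by
    intro a b ha hb hlt
    have hab : a ≠ b := fun h => by subst h; omega
    have hua := hu2 (halfIndex d a) (halfIndex d b) a rfl
    have hub := hu3 (halfIndex d a) (halfIndex d b) b rfl hlt.ne
    refine hcon (u (halfIndex d a) (halfIndex d b)) (mem_union_left _ (mem_image.2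
      ⟨⟨halfIndex d b, halfIndex d a⟩, mem_sigma.2 ⟨mem_range.2 (hM b (hAx b hb)),
        mem_range.2 hlt⟩, rfl⟩)) ⟨?_, fun h => ?_⟩
    · rw [sum_eq_add a b hab, ha, hb, hua, hub]
      · norm_num
      · intro c _ hc
        by_contra hne
        have hAc : A c = 1 := (hA c).resolve_left (left_ne_zero_of_mul hne)
        have hcW := hu4 _ _ c (right_ne_zero_of_mul hne)
        rw [halfIndex_div_two hd, halfIndex_div_two hd] at hcW
        rcases mem_union.1 hcW with h | h
        · exact hc.1 (hone _ (hm a (hAx a ha)) c h a (hself a) hAc ha)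
        · exact hc.2 (hone _ (hm b (hAx b hb)) c h b (hself b) hAc hb)
      · simp
      · simp
    · rcases h a with h | h <;> omega
  rcases hneq.lt_or_gt with h | h
  · exact main a b ha hb h
  · exact main b a hb ha h

/-- A full-support sign vector is never orthogonal to a point with three ones. -/
lemma not_isCovering_self {n : ℕ} (hn : 4 ≤ n) (𝒱 : Finset (Fin n → ℤ)) :
    ¬ IsCovering n n 𝒱 := by
  rintro ⟨h1, h2⟩
  obtain ⟨V, hV, h0, -⟩ := h2 (fun i => if i.val < 3 then 1 else 0)
    (fun i => by dsimp only; split_ifs <;> simp) (by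
      rintro (h | ⟨j, h⟩ | ⟨-, h⟩)
      · simpa using h ⟨0, by omega⟩
      · have e0 := h ⟨0, by omega⟩
        have e1 := h ⟨1, by omega⟩
        simp only [Fin.ext_iff] at e0 e1
        split_ifs at e0 e1 <;> omega
      · simpa using h ⟨3, by omega⟩)
  obtain ⟨hs, hc⟩ := h1 V hV
  have hne : ∀ i, V i ≠ 0 := by
    have : (univ.filter fun i => V i ≠ 0) = univ := by
      rw [← card_eq_iff_eq_univ, hc, Fintype.card_fin]
    intro i
    simpa using this.ge (mem_univ i)
  obtain ⟨k, rfl⟩ : ∃ k, n = 3 + k := ⟨n - 3, by omega⟩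
  rw [Fin.sum_univ_add] at h0
  simp only [Fin.sum_univ_three, Fin.val_castAdd, Fin.val_natAdd] at h0
  simp at h0
  have a0 := hs (Fin.castAdd k 0)
  have a1 := hs (Fin.castAdd k 1)
  have a2 := hs (Fin.castAdd k 2)
  have b0 := hne (Fin.castAdd k 0)
  have b1 := hne (Fin.castAdd k 1)
  have b2 := hne (Fin.castAdd k 2)
  omega

lemma isCovering_two : IsCovering 2 2 {![1, -1]} := by
  refine ⟨fun V hV => ?_, fun A hA hnt => ⟨_, mem_singleton_self _, ?_⟩⟩
  · rw [mem_singleton.1 hV]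
    exact ⟨by decide, by decide⟩
  · unfold TrivialPt at hnt
    unfold NonTrivOrth TrivOrth
    have h0 := hA 0
    have h1 := hA 1
    rcases h0 with h0 | h0 <;> rcases h1 with h1 | h1 <;>
      simp_all [Fin.forall_fin_succ, Fin.exists_fin_succ, Fin.sum_univ_succ]

lemma isCovering_three : IsCovering 3 3 {![1, -1, 1], ![1, 1, -1]} := by
  refine ⟨fun V hV => ?_, fun A hA hnt => ?_⟩
  · rcases mem_insert.1 hV with rfl | hV
    · exact ⟨by decide, by decide⟩
    · rw [mem_singleton.1 hV]
      exact ⟨by decide, by decide⟩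
  · unfold TrivialPt at hnt
    simp only [mem_insert, mem_singleton, exists_eq_or_imp, exists_eq_left]
    unfold NonTrivOrth TrivOrth
    have h3 : Odd 3 := by decide
    rcases hA 0 with h0 | h0 <;> rcases hA 1 with h1 | h1 <;> rcases hA 2 with h2 | h2 <;>
      simp_all [Fin.forall_fin_succ, Fin.exists_fin_succ, Fin.sum_univ_succ]

lemma beta_le_card {n d : ℕ} {𝒱 : Finset (Fin n → ℤ)} (h : IsCovering n d 𝒱) :
    beta n d ≤ 𝒱.card :=
  Nat.sInf_le ⟨𝒱, rfl, h⟩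

/-- For `2 ≤ d ≤ n`,
`β^d(n) ≤ C(⌈2(n-1)/(d-1)⌉, 2) + ⌈(n-1)/(d-1)⌉·(d+1)`. -/
theorem beta_upper_bound (n d : ℕ) (hd : 2 ≤ d) (hdn : d ≤ n) :
    beta n d ≤
      Nat.choose ⌈(2 * ((n : ℚ) - 1)) / ((d : ℚ) - 1)⌉₊ 2 +
        ⌈((n : ℚ) - 1) / ((d : ℚ) - 1)⌉₊ * (d + 1) := by
  rcases hdn.lt_or_eq with hlt | rfl
  · have hd1 : (0 : ℚ) < (d : ℚ) - 1 := by
      have : (2 : ℚ) ≤ d := by exact_mod_cast hd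
      linarith
    have hcast : (d : ℚ) - 1 = ((d - 1 : ℕ) : ℚ) := by
      rw [Nat.cast_sub (by omega), Nat.cast_one]
    have hn1 : (n : ℚ) - 1 = ((n - 1 : ℕ) : ℚ) := by
      rw [Nat.cast_sub (by omega), Nat.cast_one]
    obtain ⟨𝒱, hc, hV⟩ := exists_covering hd hlt
      (M := ⌈(2 * ((n : ℚ) - 1)) / ((d : ℚ) - 1)⌉₊) (m := ⌈((n : ℚ) - 1) / ((d : ℚ) - 1)⌉₊)
      (fun e he => by
        rw [Nat.lt_ceil, lt_div_iff₀ hd1, hn1, hcast]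
        have := halfIndex_mul_le hd e
        exact_mod_cast (show halfIndex d e * (d - 1) < 2 * (n - 1) by omega))
      (fun e he => by
        rw [Nat.lt_ceil, lt_div_iff₀ hd1, hn1, hcast]
        exact_mod_cast (Nat.div_mul_le_self e (d - 1)).trans_lt he)
    exact (beta_le_card hV).trans hc
  · rcases le_or_gt 4 d with h4 | h4
    · have : beta d d = 0 := by
        refine Nat.sInf_eq_zero.2 (Or.inr ?_)
        rw [Set.eq_empty_iff_forall_notMem]
        rintro t ⟨𝒱, -, h⟩
        exact not_isCovering_self h4 𝒱 h
      omega
    · obtain rfl | rfl : d = 2 ∨ d = 3 := by omega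
      · refine (beta_le_card isCovering_two).trans ?_
        norm_num
      · refine (beta_le_card isCovering_three).trans (card_le_two.trans ?_)
        norm_num
end

section
/- For every even integer d ≥ 2, β^d(d+1) = d + 1. -/
open Finset

/-- A walk on `ℤ` starting at `0` with steps of size at most one crosses half of any positive odd
value it attains. -/
lemma exists_add_succ_eq_of_pos (a : ℕ → ℤ) (n : ℕ) (h0 : a 0 = 0)
    (hstep : ∀ k, |a (k + 1) - a k| ≤ 1) (hodd : Odd (a n)) (hpos : 0 < a n) :
    ∃ z < n, a z + a (z + 1) = a n := by
  have hex : ∃ k, a n < 2 * a k := ⟨n, by omega⟩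
  obtain ⟨m, hm⟩ := hodd
  have hfind := Nat.find_spec hex
  have hle : Nat.find hex ≤ n := Nat.find_min' hex (by omega)
  rcases hk : Nat.find hex with _ | z
  · rw [hk, h0] at hfind
    omega
  · have hz := Nat.find_min hex (m := z) (by omega)
    have hs := abs_le.mp (hstep z)
    rw [hk] at hfind
    exact ⟨z, by omega, by omega⟩

/-- A walk on `ℤ` starting at `0` with steps of size at most one crosses half of any odd value it
attains. -/
lemma exists_add_succ_eq_of_odd (a : ℕ → ℤ) (n : ℕ) (h0 : a 0 = 0)
    (hstep : ∀ k, |a (k + 1) - a k| ≤ 1) (hodd : Odd (a n)) :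
    ∃ z < n, a z + a (z + 1) = a n := by
  rcases lt_trichotomy (a n) 0 with h | h | h
  · obtain ⟨z, hz, hs⟩ := exists_add_succ_eq_of_pos (fun k => -a k) n (by simp [h0])
      (fun k => by rw [← abs_neg]; simpa [add_comm, sub_eq_add_neg] using hstep k)
      hodd.neg (by simpa using h)
    exact ⟨z, hz, by linarith⟩
  · simp [h] at hodd
  · exact exists_add_succ_eq_of_pos a n h0 hstep hodd h

lemma alternating_sum_step {b : ℕ → ℤ} (hb : ∀ i, b i = 0 ∨ b i = 1) (k : ℕ) :
    |∑ i ∈ range (k + 1), (-1) ^ i * b i - ∑ i ∈ range k, (-1) ^ i * b i| ≤ 1 := by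
  rw [sum_range_succ, add_sub_cancel_left, abs_mul, abs_pow, abs_neg, abs_one, one_pow, one_mul]
  rcases hb k with h | h <;> simp [h]

/-- The alternating partial sums of a `0`-`1` sequence, taken up to an odd index, cross half of
their final value. -/
lemma exists_alternating_sum_add_succ_eq {b : ℕ → ℤ} (hb : ∀ i, b i = 0 ∨ b i = 1) {n : ℕ}
    (hn : Odd n) :
    ∃ z < n, ∑ i ∈ range z, (-1) ^ i * b i + ∑ i ∈ range (z + 1), (-1) ^ i * b i =
      ∑ i ∈ range n, (-1) ^ i * b i := by
  have halt (k : ℕ) : ∑ i ∈ range k, (-1 : ℤ) ^ i = if Even k then 0 else 1 :=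
    neg_one_geom_sum
  rcases Int.even_or_odd (∑ i ∈ range n, (-1) ^ i * b i) with h | h
  · have hcompl (k : ℕ) : ∑ i ∈ range k, (-1) ^ i * (1 - b i) =
        (if Even k then 0 else 1) - ∑ i ∈ range k, (-1) ^ i * b i := by
      rw [← halt k, ← sum_sub_distrib]
      exact sum_congr rfl fun i _ => by ring
    have hb' (i : ℕ) : 1 - b i = 0 ∨ 1 - b i = 1 := by have := hb i; omega
    have hn' : ¬ Even n := Nat.not_even_iff_odd.mpr hn
    obtain ⟨z, hz, hs⟩ := exists_add_succ_eq_of_odd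
      (fun k => ∑ i ∈ range k, (-1) ^ i * (1 - b i)) n (by simp)
      (fun k => alternating_sum_step hb' k) (by simpa only [hcompl, if_neg hn'] using odd_one.sub_even h)
    refine ⟨z, hz, ?_⟩
    simp only [hcompl, if_neg hn', Nat.even_add_one] at hs
    split_ifs at hs <;> omega
  · exact exists_add_succ_eq_of_odd (fun k => ∑ i ∈ range k, (-1) ^ i * b i) n (by simp)
      (fun k => alternating_sum_step hb k) h

/-- The vector with entries alternating in sign around the cycle, starting after a zero at `z`. -/
def alternatingVec {n : ℕ} (z i : Fin n) : ℤ :=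
  if i = z then 0 else if i < z then -(-1) ^ (i : ℕ) else (-1) ^ (i : ℕ)

lemma alternatingVec_eq_zero_iff {n : ℕ} {z i : Fin n} : alternatingVec z i = 0 ↔ i = z := by
  unfold alternatingVec
  split_ifs with h h' <;> simp [h]

lemma isSignVec_alternatingVec {d : ℕ} (z : Fin (d + 1)) : IsSignVec d (alternatingVec z) := by
  constructor
  · intro i
    unfold alternatingVec
    rcases neg_one_pow_eq_or ℤ (i : ℕ) with h | h <;> split_ifs <;> simp [h]
  · simp [alternatingVec_eq_zero_iff, filter_ne']

lemma sum_mul_alternatingVec {n : ℕ} (b : ℕ → ℤ) (z : Fin n) :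
    ∑ i : Fin n, b i * alternatingVec z i =
      ∑ i ∈ range n, (-1) ^ i * b i -
        (∑ i ∈ range z, (-1) ^ i * b i + ∑ i ∈ range (z + 1), (-1) ^ i * b i) := by
  have hrestrict (k : ℕ) (hk : k ≤ n) : ∑ i ∈ range k, (-1) ^ i * b i =
      ∑ i ∈ range n, if i < k then (-1) ^ i * b i else 0 := by
    rw [← sum_filter]
    congr 1
    ext i
    simp only [mem_range, mem_filter]
    omega
  rw [hrestrict z (by omega), hrestrict (z + 1) (by omega), ← sum_add_distrib, ← sum_sub_distrib,
    ← Fin.sum_univ_eq_sum_range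
      (fun i => (-1) ^ i * b i - ((if i < (z : ℕ) then (-1) ^ i * b i else 0) +
        if i < (z : ℕ) + 1 then (-1) ^ i * b i else 0))]
  refine sum_congr rfl fun i _ => ?_
  simp only [alternatingVec, Fin.ext_iff, Fin.lt_def]
  split_ifs <;> first | omega | ring

lemma exists_one_ne_of_not_trivialPt {n d : ℕ} {A : Fin n → ℤ} (hA : IsCubePt A)
    (hT : ¬ TrivialPt d A) (z : Fin n) : ∃ i, i ≠ z ∧ A i = 1 := by
  by_contra! h
  have h0 (i : Fin n) (hi : i ≠ z) : A i = 0 := (hA i).resolve_right (h i hi)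
  refine hT ?_
  rcases hA z with hz | hz
  · refine Or.inl fun i => ?_
    by_cases hi : i = z
    · rw [hi, hz]
    · exact h0 i hi
  · refine Or.inr (Or.inl ⟨z, fun i => ?_⟩)
    split_ifs with hi
    · rw [hi, hz]
    · exact h0 i hi

lemma isCovering_image_alternatingVec {d : ℕ} (hd : Even d) :
    IsCovering (d + 1) d (univ.image alternatingVec) := by
  constructor
  · simp only [mem_image, mem_univ, true_and, forall_exists_index, forall_apply_eq_imp_iff]
    exact isSignVec_alternatingVec
  · intro A hA hT
    let b : ℕ → ℤ := fun i => if h : i < d + 1 then A ⟨i, h⟩ else 0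
    have hbA (i : Fin (d + 1)) : b i = A i := dif_pos i.isLt
    have hb (i : ℕ) : b i = 0 ∨ b i = 1 := by
      by_cases h : i < d + 1
      · rw [show b i = A ⟨i, h⟩ from hbA ⟨i, h⟩]
        exact hA ⟨i, h⟩
      · exact Or.inl (dif_neg h)
    obtain ⟨z, hz, hs⟩ := exists_alternating_sum_add_succ_eq hb hd.add_one
    refine ⟨alternatingVec ⟨z, hz⟩, mem_image_of_mem _ (mem_univ _), ?_, fun h => ?_⟩
    · simp_rw [← hbA]
      rw [sum_mul_alternatingVec, hs, sub_self]
    · obtain ⟨i, hi, hi'⟩ := exists_one_ne_of_not_trivialPt hA hT ⟨z, hz⟩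
      rcases h i with h | h
      · omega
      · exact hi (alternatingVec_eq_zero_iff.mp h)

lemma IsSignVec.even_sum {n d : ℕ} {V : Fin n → ℤ} (hV : IsSignVec d V) (hd : Even d) :
    Even (∑ i, V i) := by
  have h : Even (∑ i, V i - ∑ i, if V i ≠ 0 then (1 : ℤ) else 0) := by
    rw [← sum_sub_distrib]
    refine Finset.even_sum _ fun i _ => ?_
    rcases hV.1 i with h | h | h <;> simp [h]
  have hcard : ∑ i, (if V i ≠ 0 then (1 : ℤ) else 0) = d := by
    rw [sum_boole, hV.2]
  rw [hcard, Int.even_sub] at h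
  exact h.mpr (by exact_mod_cast hd)

lemma IsSignVec.eq_of_apply_eq_zero {d : ℕ} {V : Fin (d + 1) → ℤ} (hV : IsSignVec d V)
    {z w : Fin (d + 1)} (hz : V z = 0) (hw : V w = 0) : z = w := by
  have h := card_filter_add_card_filter_not (s := (univ : Finset (Fin (d + 1)))) (fun i => V i ≠ 0)
  rw [hV.2, card_univ, Fintype.card_fin] at h
  exact card_le_one.mp (by omega : (univ.filter fun i => ¬ V i ≠ 0).card ≤ 1) z (by simp [hz]) w
    (by simp [hw])

lemma IsCovering.exists_apply_eq_zero {d : ℕ} (hd : 2 ≤ d) (heven : Even d)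
    {𝒱 : Finset (Fin (d + 1) → ℤ)} (h𝒱 : IsCovering (d + 1) d 𝒱) (z : Fin (d + 1)) :
    ∃ V ∈ 𝒱, V z = 0 := by
  obtain ⟨i, j, hiz, hjz, hij⟩ : ∃ i j : Fin (d + 1), i ≠ z ∧ j ≠ z ∧ i ≠ j := by
    have h : 1 < (univ.erase z).card := by simp; omega
    obtain ⟨i, hi, j, hj, hij⟩ := one_lt_card.mp h
    exact ⟨i, j, ne_of_mem_erase hi, ne_of_mem_erase hj, hij⟩
  obtain ⟨V, hV, horth, -⟩ := h𝒱.2 (fun k => if k = z then 0 else 1)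
    (fun k => by dsimp only; split_ifs <;> simp) (by
      rintro (h | ⟨k, h⟩ | ⟨h, -⟩)
      · simpa [hiz] using h i
      · have hi := h i
        have hj := h j
        simp only [hiz, hjz, if_false] at hi hj
        split_ifs at hi hj with h₁ h₂ <;> omega
      · exact Nat.not_even_iff_odd.mpr h heven)
  refine ⟨V, hV, ?_⟩
  have hsum : ∑ k, V k = V z := by
    rw [← sub_eq_zero, ← horth, ← sum_erase_eq_sub (mem_univ z)]
    simp [ite_mul, sum_ite, filter_ne']
  have hVz := hsum ▸ (h𝒱.1 V hV).even_sum heven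
  rcases (h𝒱.1 V hV).1 z with h | h | h
  · simp [h] at hVz
  · exact h
  · simp [h] at hVz

/-- For every even integer `d ≥ 2`, `β^d(d+1) = d + 1`. -/
theorem beta_succ_even (d : ℕ) (hd : 2 ≤ d) (heven : Even d) :
    beta (d + 1) d = d + 1 := by
  have hcard : (univ.image (alternatingVec (n := d + 1))).card = d + 1 := by
    rw [card_image_of_injective, card_univ, Fintype.card_fin]
    intro z w h
    exact alternatingVec_eq_zero_iff.mp (h ▸ alternatingVec_eq_zero_iff.mpr rfl)
  have hmem : d + 1 ∈ {t | ∃ 𝒱 : Finset (Fin (d + 1) → ℤ), 𝒱.card = t ∧ IsCovering (d + 1) d 𝒱} :=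
    ⟨_, hcard, isCovering_image_alternatingVec heven⟩
  refine le_antisymm (Nat.sInf_le hmem) (le_csInf ⟨_, hmem⟩ ?_)
  rintro _ ⟨𝒱, rfl, h𝒱⟩
  choose f hf hf0 using h𝒱.exists_apply_eq_zero hd heven
  have h := card_le_card_of_injOn f (s := univ) (t := 𝒱) (fun z _ => hf z) fun z _ w _ hzw =>
    (h𝒱.1 _ (hf z)).eq_of_apply_eq_zero (hf0 z) (hzw ▸ hf0 w)
  simpa using h
end

section
/- For every odd integer d ≥ 3, d ≤ β^d(d+1) ≤ d + 1. -/
open Finset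

/-! ### Lower bound -/

/-- The alternating sum over the subsets of `T` of a product of fewer than `#T` affine
functions vanishes. -/
theorem sum_powerset_neg_one_pow_mul_prod_affine {ι κ R : Type*} [DecidableEq ι] [CommRing R]
    (v : κ → ι → R) (s : Finset κ) (a : κ → R) (T : Finset ι) (h : s.card < T.card) :
    ∑ S ∈ T.powerset, (-1) ^ S.card * ∏ j ∈ s, (a j + ∑ i ∈ S, v j i) = 0 := by
  classical
  induction s using Finset.induction_on generalizing a T with
  | empty =>
    have hT : T ≠ ∅ := by rintro rfl; simp at h
    have := congrArg (Int.cast : ℤ → R) (Finset.sum_powerset_neg_one_pow_card (x := T))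
    simpa [hT] using this
  | insert j s hj ih =>
    rw [Finset.card_insert_of_notMem hj] at h
    have expand : ∀ S ∈ T.powerset,
        (-1 : R) ^ S.card * ∏ l ∈ insert j s, (a l + ∑ i ∈ S, v l i) =
          a j * ((-1) ^ S.card * ∏ l ∈ s, (a l + ∑ i ∈ S, v l i)) +
          ∑ i ∈ T, if i ∈ S then
            v j i * ((-1) ^ S.card * ∏ l ∈ s, (a l + ∑ i ∈ S, v l i)) else 0 := by
      intro S hS
      rw [← Finset.sum_filter, Finset.filter_mem_eq_inter,
        Finset.inter_eq_right.2 (Finset.mem_powerset.1 hS), ← Finset.sum_mul,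
        Finset.prod_insert hj]
      ring
    rw [Finset.sum_congr rfl expand, Finset.sum_add_distrib, ← Finset.mul_sum,
      ih a T (by omega), mul_zero, zero_add, Finset.sum_comm]
    refine Finset.sum_eq_zero fun i hi => ?_
    obtain ⟨T, hiT, rfl⟩ : ∃ T', i ∉ T' ∧ insert i T' = T :=
      ⟨T.erase i, Finset.notMem_erase i T, Finset.insert_erase hi⟩
    rw [Finset.card_insert_of_notMem hiT] at h
    rw [Finset.sum_powerset_insert hiT]
    have hnot : ∀ S ∈ T.powerset, i ∉ S := fun S hS hiS => hiT (Finset.mem_powerset.1 hS hiS)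
    rw [Finset.sum_eq_zero fun S hS => if_neg (hnot S hS), zero_add]
    have key := ih (fun l => a l + v l i) T (by omega)
    rw [← mul_zero (-v j i), ← key, Finset.mul_sum]
    refine Finset.sum_congr rfl fun S hS => ?_
    rw [if_pos (Finset.mem_insert_self i S), Finset.card_insert_of_notMem (hnot S hS)]
    simp only [Finset.sum_insert (hnot S hS), add_assoc]
    ring

theorem IsSignVec.sum_ne_zero {n d : ℕ} {V : Fin n → ℤ} (hV : IsSignVec d V) (hodd : Odd d) :
    ∑ i, V i ≠ 0 := by
  intro h
  have hmod : ∀ i, (V i : ZMod 2) = if V i ≠ 0 then 1 else 0 := by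
    intro i
    rcases hV.1 i with h | h | h <;> rw [h] <;> decide
  have hcast := congrArg (Int.cast : ℤ → ZMod 2) h
  rw [Int.cast_sum, Finset.sum_congr rfl fun i _ => hmod i, Finset.sum_boole, hV.2,
    Int.cast_zero, ZMod.natCast_eq_zero_iff_even] at hcast
  exact Nat.not_even_iff_odd.2 hodd hcast

/-- A covering contains a vector orthogonal to the indicator of any proper subset with at
least two elements. -/
theorem IsCovering.exists_sum_eq_zero {n d : ℕ} {𝒱 : Finset (Fin n → ℤ)} (h : IsCovering n d 𝒱)
    {U : Finset (Fin n)} (hU : 2 ≤ U.card) (hU' : U ≠ Finset.univ) :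
    ∃ V ∈ 𝒱, ∑ i ∈ U, V i = 0 := by
  obtain ⟨V, hV, hdot, -⟩ := h.2 (fun i => if i ∈ U then 1 else 0)
    (fun i => by by_cases hi : i ∈ U <;> simp [hi]) (by
      rintro (h0 | ⟨j, hj⟩ | ⟨-, h1⟩)
      · obtain ⟨x, hx⟩ : U.Nonempty := Finset.card_pos.1 (by omega)
        simpa [hx] using h0 x
      · have hsub : U ⊆ {j} := fun x hx => by
          have := hj x
          by_contra hne
          simp_all
        have := Finset.card_le_card hsub
        simp at this
        omega
      · refine hU' (Finset.eq_univ_iff_forall.2 fun x => ?_)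
        have := h1 x
        by_contra hx
        simp [hx] at this)
  exact ⟨V, hV, by simpa [Finset.sum_ite_mem] using hdot⟩

theorem IsCovering.le_card {d : ℕ} (hd : 2 ≤ d) (hodd : Odd d) {𝒱 : Finset (Fin (d + 1) → ℤ)}
    (h : IsCovering (d + 1) d 𝒱) : d ≤ 𝒱.card := by
  by_contra! hlt
  obtain ⟨U, hU⟩ : ∃ U : Finset (Fin (d + 1)), U.card = 2 := by
    obtain ⟨U, -, hU⟩ := Finset.exists_subset_card_eq
      (s := (Finset.univ : Finset (Fin (d + 1)))) (n := 2) (by simp; omega)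
    exact ⟨U, hU⟩
  obtain ⟨V₀, hV₀, -⟩ := h.exists_sum_eq_zero (U := U) hU.ge (by rintro rfl; simp at hU; omega)
  obtain ⟨k, hk⟩ : ∃ k, V₀ k = 0 := by
    by_contra! hne
    have := (h.1 V₀ hV₀).2
    simp [hne] at this
  have key := sum_powerset_neg_one_pow_mul_prod_affine (fun (V : Fin (d + 1) → ℤ) i => V i) 𝒱
    (fun V => V k) (Finset.univ.erase k) (by simpa using hlt)
  have hkS : ∀ S ⊆ Finset.univ.erase k, k ∉ S := fun S hS hkS => by simpa using hS hkS
  rw [Finset.sum_eq_single_of_mem (Finset.univ.erase k) (Finset.mem_powerset_self _)] at key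
  · have hprod := (mul_eq_zero.1 key).resolve_left (by simp)
    obtain ⟨V, hV, hsum⟩ := Finset.prod_eq_zero_iff.1 hprod
    rw [Finset.add_sum_erase _ _ (Finset.mem_univ k)] at hsum
    exact (h.1 V hV).sum_ne_zero hodd hsum
  · intro S hS hne
    rw [Finset.mem_powerset] at hS
    rcases S.eq_empty_or_nonempty with rfl | hpos
    · rw [Finset.prod_eq_zero hV₀ (by simpa using hk), mul_zero]
    · obtain ⟨V, hV, hsum⟩ := h.exists_sum_eq_zero (U := insert k S)
        (by
          rw [Finset.card_insert_of_notMem (hkS S hS)]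
          have := hpos.card_pos
          omega)
        (fun hU => hne (by rw [← hU, Finset.erase_insert (hkS S hS)]))
      rw [Finset.sum_insert (hkS S hS)] at hsum
      rw [Finset.prod_eq_zero hV hsum, mul_zero]

/-! ### Upper bound -/

/-- A `2m`-periodic `{0,1}`-sequence that is not constantly `1` is balanced by one of the
rotations of the half-and-half sign pattern whose first entry is erased. -/
theorem exists_half_sum_eq (m : ℕ) (a : ℕ → ℤ) (h01 : ∀ k, a k = 0 ∨ a k = 1)
    (hper : ∀ k, a (k + 2 * m) = a k) (hne : ∃ k, a k ≠ 1) :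
    ∃ i, ∑ r ∈ Finset.range m, a (i + r) - ∑ r ∈ Finset.range m, a (i + m + r) = a i := by
  by_contra! hcon
  set h : ℕ → ℤ := fun i =>
    ∑ r ∈ Finset.range m, a (i + r) - ∑ r ∈ Finset.range m, a (i + m + r) with hdef
  have hg : ∀ i, h i ≠ a i := hcon
  have hanti : ∀ i, h (i + m) = -h i := by
    intro i
    have : ∀ r, a (i + m + m + r) = a (i + r) := fun r => by
      rw [← hper (i + r)]; congr 1; ring
    simp only [hdef, this]
    ring
  have hshift : ∀ i, ∑ r ∈ Finset.range m, a (i + 1 + r) =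
      ∑ r ∈ Finset.range m, a (i + r) + a (i + m) - a i := by
    intro i
    have h1 := Finset.sum_range_succ (fun r => a (i + r)) m
    have h2 := Finset.sum_range_succ' (fun r => a (i + r)) m
    have : ∀ r, a (i + 1 + r) = a (i + (r + 1)) := fun r => by congr 1; ring
    simp only [this]
    simp only [add_zero] at h2
    linarith
  have hstep : ∀ i, h (i + 1) = h i + 2 * a (i + m) - 2 * a i := by
    intro i
    have h1 := hshift i
    have h2 := hshift (i + m)
    have h3 : i + m + 1 = i + 1 + m := by ring
    have h4 : a (i + m + m) = a i := by rw [← hper i]; congr 1; ring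
    rw [h3, h4] at h2
    simp only [hdef, h1, h2]
    ring
  have hg' : ∀ i, h i ≠ -a (i + m) := fun i hi => hg (i + m) (by rw [hanti, hi, neg_neg])
  have hnz : ∀ i, h i ≠ 0 := by
    intro i hi
    have hall : ∀ j, h (i + j) = 0 := by
      intro j
      induction j with
      | zero => exact hi
      | succ j ih =>
        have h1 := hg (i + j)
        have h2 := hg' (i + j)
        have h3 := hstep (i + j)
        rcases h01 (i + j) with h4 | h4 <;> rcases h01 (i + j + m) with h5 | h5 <;>
          rw [← add_assoc] <;> omega
    obtain ⟨k, hk⟩ := hne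
    have hperk : ∀ q, a (k + 2 * m * q) = a k := by
      intro q
      induction q with
      | zero => simp
      | succ q ih => rw [← ih, ← hper (k + 2 * m * q)]; congr 1; ring
    have hm : m ≠ 0 := by
      rintro rfl
      apply hk
      have := hg k
      simp only [hdef, Finset.range_zero, Finset.sum_empty] at this
      rcases h01 k with h | h <;> omega
    have hle : i ≤ k + 2 * m * i := by nlinarith [Nat.pos_of_ne_zero hm]
    obtain ⟨j, hj⟩ := Nat.exists_eq_add_of_le hle
    have h1 := hg (i + j)
    rw [← hj, hperk i, hj, hall j] at h1
    rcases h01 k with h | h <;> omega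
  have hpos : ∀ i, 0 < h i → ∀ j, 0 < h (i + j) := by
    intro i hi j
    induction j with
    | zero => exact hi
    | succ j ih =>
      have h1 := hg (i + j)
      have h3 := hstep (i + j)
      have h6 := hnz (i + j + 1)
      rw [← add_assoc]
      rcases h01 (i + j) with h4 | h4 <;> rcases h01 (i + j + m) with h5 | h5 <;> omega
  have hnonpos : ∀ i, ¬ 0 < h i := fun i hi => by
    have := hpos i hi m
    rw [hanti] at this
    omega
  have h1 := hnonpos 0
  have h2 := hnonpos (0 + m)
  rw [hanti] at h2
  exact hnz 0 (by omega)

/-- The sign pattern on `{0, …, 2m - 1}` with one `0`, then `m - 1` ones, then `m` minus ones,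
rotated so that it starts at `i`. -/
def rotatedPattern (d m : ℕ) (i : Fin (d + 1)) (j : Fin (d + 1)) : ℤ :=
  if j - i = 0 then 0 else if (j - i).val < m then 1 else -1

theorem rotatedPattern_eq_zero_iff {d m : ℕ} {i j : Fin (d + 1)} :
    rotatedPattern d m i j = 0 ↔ j = i := by
  unfold rotatedPattern
  split_ifs with h1 h2
  · simpa [sub_eq_zero] using h1
  · simpa [sub_eq_zero] using h1
  · simpa [sub_eq_zero] using h1

theorem isSignVec_rotatedPattern (d m : ℕ) (i : Fin (d + 1)) :
    IsSignVec d (rotatedPattern d m i) := by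
  constructor
  · intro j
    unfold rotatedPattern
    split_ifs <;> simp
  · simp only [ne_eq, rotatedPattern_eq_zero_iff]
    rw [Finset.filter_ne', Finset.card_erase_of_mem (Finset.mem_univ i)]
    simp

theorem sum_mul_rotatedPattern {d m : ℕ} (hm : d + 1 = 2 * m) (A : Fin (d + 1) → ℤ) (i : ℕ) :
    ∑ j, A j * rotatedPattern d m (Fin.ofNat (d + 1) i) j =
      ∑ r ∈ Finset.range m, A (Fin.ofNat (d + 1) (i + r)) -
        ∑ r ∈ Finset.range m, A (Fin.ofNat (d + 1) (i + m + r)) - A (Fin.ofNat (d + 1) i) := by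
  have hterm : ∀ r : Fin (d + 1),
      A (Fin.ofNat (d + 1) i + r) *
        rotatedPattern d m (Fin.ofNat (d + 1) i) (Fin.ofNat (d + 1) i + r) =
      (fun r : ℕ => A (Fin.ofNat (d + 1) (i + r)) * (if r < m then 1 else -1) -
        if r = 0 then A (Fin.ofNat (d + 1) i) else 0) r.val := by
    intro r
    have hadd : Fin.ofNat (d + 1) i + r = Fin.ofNat (d + 1) (i + r.val) := by
      ext
      simp [Fin.val_add]
    unfold rotatedPattern
    rw [add_sub_cancel_left, hadd]
    by_cases hr : r = 0
    · subst hr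
      simp [show 0 < m by omega]
    · have : r.val ≠ 0 := fun h => hr (Fin.ext h)
      simp [hr]
  rw [← Equiv.sum_comp (Equiv.addLeft (Fin.ofNat (d + 1) i))]
  simp only [Equiv.coe_addLeft]
  rw [Finset.sum_congr rfl fun r _ => hterm r,
    Fin.sum_univ_eq_sum_range (fun r : ℕ =>
      A (Fin.ofNat (d + 1) (i + r)) * (if r < m then 1 else -1) -
        if r = 0 then A (Fin.ofNat (d + 1) i) else 0),
    Finset.sum_sub_distrib, Finset.sum_ite_eq', if_pos (by simp),
    show Finset.range (d + 1) = Finset.range (m + m) by rw [hm, two_mul], Finset.sum_range_add]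
  congr 1
  rw [sub_eq_add_neg, ← Finset.sum_neg_distrib]
  congr 1
  · refine Finset.sum_congr rfl fun r hr => ?_
    rw [if_pos (Finset.mem_range.1 hr), mul_one]
  · refine Finset.sum_congr rfl fun r _ => ?_
    rw [if_neg (by omega), mul_neg_one, add_assoc]

theorem isCovering_rotatedPattern {d m : ℕ} (hm : d + 1 = 2 * m) :
    IsCovering (d + 1) d (Finset.univ.image (rotatedPattern d m)) := by
  constructor
  · intro V hV
    obtain ⟨i, -, rfl⟩ := Finset.mem_image.1 hV
    exact isSignVec_rotatedPattern d m i
  · intro A hA hnt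
    have hodd : Odd d := ⟨m - 1, by omega⟩
    have hne : ∃ k, A k ≠ 1 := by
      by_contra! h
      exact hnt (Or.inr (Or.inr ⟨hodd, h⟩))
    obtain ⟨i, hi⟩ := exists_half_sum_eq m (fun k => A (Fin.ofNat (d + 1) k)) (fun k => hA _)
      (fun k => by
        congr 1
        ext
        simp [← hm])
      (by
        obtain ⟨k, hk⟩ := hne
        refine ⟨k.val, ?_⟩
        simpa using hk)
    refine ⟨_, Finset.mem_image_of_mem _ (Finset.mem_univ (Fin.ofNat (d + 1) i)), ?_, ?_⟩
    · rw [sum_mul_rotatedPattern hm, hi, sub_self]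
    · intro htriv
      have hzero : ∀ j, j ≠ Fin.ofNat (d + 1) i → A j = 0 := fun j hj =>
        (htriv j).resolve_right fun h => hj (rotatedPattern_eq_zero_iff.1 h)
      rcases hA (Fin.ofNat (d + 1) i) with h | h
      · refine hnt (Or.inl fun j => ?_)
        by_cases hj : j = Fin.ofNat (d + 1) i
        · rw [hj, h]
        · exact hzero j hj
      · refine hnt (Or.inr (Or.inl ⟨Fin.ofNat (d + 1) i, fun j => ?_⟩))
        by_cases hj : j = Fin.ofNat (d + 1) i
        · rw [if_pos hj, hj, h]
        · rw [if_neg hj, hzero j hj]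

/-- For every odd integer `d ≥ 3`, `d ≤ β^d(d+1) ≤ d + 1`. -/
theorem beta_succ_odd (d : ℕ) (hd : 3 ≤ d) (hodd : Odd d) :
    d ≤ beta (d + 1) d ∧ beta (d + 1) d ≤ d + 1 := by
  obtain ⟨l, hl⟩ := hodd
  have hcov := isCovering_rotatedPattern (d := d) (m := l + 1) (by omega)
  constructor
  · obtain ⟨𝒱, hcard, h𝒱⟩ := Nat.sInf_mem
      (s := {t | ∃ 𝒱 : Finset (Fin (d + 1) → ℤ), 𝒱.card = t ∧ IsCovering (d + 1) d 𝒱})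
      ⟨_, _, rfl, hcov⟩
    exact (h𝒱.le_card (by omega) ⟨l, hl⟩).trans_eq hcard
  · have hle : beta (d + 1) d ≤ (Finset.univ.image (rotatedPattern d (l + 1))).card :=
      Nat.sInf_le ⟨_, rfl, hcov⟩
    exact hle.trans (Finset.card_image_le.trans_eq (Finset.card_fin _))
end

section
/- Let H be a hypergraph on vertex set V(H) = {v₁,…,vₙ} and let d ∈ [n] with d ≥ 2. Let F be a family of (d+1)-element subsets of V(H) such that for every hyperedge B ∈ E(H) there exists A ∈ F with (i) |B ∩ A| ≥ 2 when d is even, or (ii) 2 ≤ |B ∩ A| ≤ d when d is odd. Then there exists an induced-bisecting family of order d for H of cardinality at most |F|·(d+1). -/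
open Finset

/-- A bicoloring `X` (a `±1` function on a subset of `[n]`, encoded as a `{-1,0,1}`-valued
function that is zero outside its domain) *induced-bisects* a set `A` if
`|A ∩ X⁻¹(+1)| = |A ∩ X⁻¹(-1)| ≠ 0`. -/
def Bisects {n : ℕ} (X : Fin n → ℤ) (A : Finset (Fin n)) : Prop :=
  (A.filter fun i => X i = 1).card = (A.filter fun i => X i = -1).card ∧
    (A.filter fun i => X i = 1).card ≠ 0

/-- `X` encodes a bicoloring of a `d`-element subset of `[n]`: it takes values in
`{-1,0,1}` and has exactly `d` nonzero values. -/
def IsBicoloring {n : ℕ} (d : ℕ) (X : Fin n → ℤ) : Prop :=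
  (∀ i, X i = -1 ∨ X i = 0 ∨ X i = 1) ∧
    (Finset.univ.filter fun i => X i ≠ 0).card = d

/-- `𝒳` is an induced-bisecting family of order `d` for the hypergraph on `[n]` with
hyperedge set `E`: every member is a bicoloring of a `d`-element set, and every
non-trivial hyperedge (one that is neither empty nor a singleton, nor — when `d` is
odd — the whole vertex set) is induced-bisected by some member. -/
def IsIBF {n : ℕ} (d : ℕ) (E : Finset (Finset (Fin n))) (𝒳 : Finset (Fin n → ℤ)) : Prop :=
  (∀ X ∈ 𝒳, IsBicoloring d X) ∧
    ∀ A ∈ E, 2 ≤ A.card → (Odd d → A ≠ Finset.univ) → ∃ X ∈ 𝒳, Bisects X A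

/-- The value of a difference in `ZMod m`. -/
lemma ZMod.val_sub_eq_ite {m : ℕ} [NeZero m] (a b : ZMod m) :
    (a - b).val = if b.val ≤ a.val then a.val - b.val else a.val + m - b.val := by
  split_ifs with h
  · exact ZMod.val_sub h
  · have hb := b.val_lt
    have key : a - b = ((a.val + m - b.val : ℕ) : ZMod m) := by
      rw [Nat.cast_sub (by omega)]
      simp
    rw [key, ZMod.val_natCast, Nat.mod_eq_of_lt (by omega)]

/-- Summing the indicator of `{a}` over a translate of `C`. -/
lemma sum_indicator_sub_eq {G : Type*} [AddCommGroup G] [DecidableEq G] (C : Finset G)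
    (a j : G) :
    ∑ i ∈ C, (if i - j = a then (1 : ℤ) else 0) = if j + a ∈ C then 1 else 0 := by
  simp only [sub_eq_iff_eq_add, add_comm a j, Finset.sum_ite_eq']

/-- The alternating pattern `0, +, -, +, -, …` on a cycle of length `m`. -/
def alternatingPattern {m : ℕ} (k : ZMod m) : ℤ :=
  if k.val = 0 then 0 else if Odd k.val then 1 else -1

/-- The pattern `0, +, …, +, -, …, -` on a cycle of length `m`, with `t` plus signs. -/
def blockPattern {m : ℕ} (t : ℕ) (k : ZMod m) : ℤ :=
  if k.val = 0 then 0 else if k.val ≤ t then 1 else -1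

lemma exists_alternatingPattern_sum_eq_zero {m : ℕ} (hm : Odd m) (hm1 : 1 < m)
    (C : Finset (ZMod m)) : ∃ j, ∑ i ∈ C, alternatingPattern (i - j) = 0 := by
  have : NeZero m := ⟨by omega⟩
  have : Fact (1 < m) := ⟨hm1⟩
  by_contra! hne
  set f : ZMod m → ℤ := fun j => ∑ i ∈ C, alternatingPattern (i - j) with hf
  have hpat (k : ZMod m) : alternatingPattern (k - 1) + alternatingPattern k =
      (if k = 1 then 1 else 0) - (if k = 0 then 1 else 0) := by
    have h1 : (1 : ZMod m).val = 1 := ZMod.val_one m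
    have e0 : k = 0 ↔ k.val = 0 := (ZMod.val_eq_zero k).symm
    have e1 : k = 1 ↔ k.val = 1 := by rw [← (ZMod.val_injective m).eq_iff, h1]
    have hs := ZMod.val_sub_eq_ite k 1
    have hk := k.val_lt
    rw [h1] at hs
    simp only [alternatingPattern, hs, e0, e1, Nat.odd_iff] at hm ⊢
    split_ifs <;> omega
  have hstep (j : ZMod m) : f (j + 1) + f j =
      (if j + 1 ∈ C then 1 else 0) - (if j ∈ C then 1 else 0) := by
    have := sum_indicator_sub_eq C 0 j
    rw [add_zero] at this
    rw [← sum_indicator_sub_eq, ← this, hf, ← Finset.sum_add_distrib, ← Finset.sum_sub_distrib]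
    refine Finset.sum_congr rfl fun i _ => ?_
    rw [← hpat, sub_add_eq_sub_sub]
  have hsign (j : ZMod m) : 0 < f (j + 1) ↔ ¬ 0 < f j := by
    have h1 : f j ≠ 0 := hne j
    have h2 : f (j + 1) ≠ 0 := hne (j + 1)
    have h3 := hstep j
    split_ifs at h3 <;> omega
  have halt (l : ℕ) : 0 < f (l : ZMod m) ↔ (Even l ↔ 0 < f 0) := by
    induction l with
    | zero => simp
    | succ l ih =>
      rw [Nat.cast_succ, hsign, ih, Nat.even_add_one]
      tauto
  have := halt m
  rw [ZMod.natCast_self, ← Nat.not_odd_iff_even] at this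
  tauto

lemma exists_blockPattern_sum_eq_zero {m t : ℕ} (hm : m = 2 * t) (ht : 2 ≤ t)
    (C : Finset (ZMod m)) (hC : ∃ j, j ∉ C) : ∃ j, ∑ i ∈ C, blockPattern t (i - j) = 0 := by
  have : NeZero m := ⟨by omega⟩
  have : Fact (1 < m) := ⟨by omega⟩
  by_contra! hne
  set f : ZMod m → ℤ := fun j => ∑ i ∈ C, blockPattern t (i - j) with hf
  have h1 : (1 : ZMod m).val = 1 := ZMod.val_one m
  have hT : (t : ZMod m).val = t := ZMod.val_cast_of_lt (by omega)
  have hT1 : ((t : ZMod m) + 1).val = t + 1 := by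
    rw [← Nat.cast_succ]; exact ZMod.val_cast_of_lt (by omega)
  have e0 (k : ZMod m) : k = 0 ↔ k.val = 0 := (ZMod.val_eq_zero k).symm
  have e1 (k : ZMod m) : k = 1 ↔ k.val = 1 := by rw [← (ZMod.val_injective m).eq_iff, h1]
  have eT (k : ZMod m) : k = t ↔ k.val = t := by rw [← (ZMod.val_injective m).eq_iff, hT]
  have eT1 (k : ZMod m) : k = t + 1 ↔ k.val = t + 1 := by
    rw [← (ZMod.val_injective m).eq_iff, hT1]
  have hpat (k : ZMod m) : blockPattern t (k - 1) - blockPattern t k =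
      2 * (if k = t + 1 then 1 else 0) - (if k = 1 then 1 else 0) - (if k = 0 then 1 else 0) := by
    have hs := ZMod.val_sub_eq_ite k 1
    have hk := k.val_lt
    rw [h1] at hs
    simp only [blockPattern, hs, e0, e1, eT1]
    split_ifs <;> omega
  have hopp (k : ZMod m) : blockPattern t (k - (t : ZMod m)) + blockPattern t k =
      (if k = t then 1 else 0) + (if k = 0 then 1 else 0) := by
    have hs := ZMod.val_sub_eq_ite k (t : ZMod m)
    have hk := k.val_lt
    rw [hT] at hs
    simp only [blockPattern, hs, e0, eT]
    split_ifs <;> omega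
  have hstep (j : ZMod m) : f (j + 1) - f j = 2 * (if j + (t + 1) ∈ C then 1 else 0) -
      (if j + 1 ∈ C then 1 else 0) - (if j ∈ C then 1 else 0) := by
    have := sum_indicator_sub_eq C 0 j
    rw [add_zero] at this
    rw [← sum_indicator_sub_eq, ← sum_indicator_sub_eq, ← this, hf, Finset.mul_sum,
      ← Finset.sum_sub_distrib, ← Finset.sum_sub_distrib, ← Finset.sum_sub_distrib]
    refine Finset.sum_congr rfl fun i _ => ?_
    rw [← hpat, sub_add_eq_sub_sub]
  have hanti (j : ZMod m) : f (j + (t : ZMod m)) + f j =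
      (if j + t ∈ C then 1 else 0) + (if j ∈ C then 1 else 0) := by
    have := sum_indicator_sub_eq C 0 j
    rw [add_zero] at this
    rw [← sum_indicator_sub_eq, ← this, hf, ← Finset.sum_add_distrib, ← Finset.sum_add_distrib]
    refine Finset.sum_congr rfl fun i _ => ?_
    rw [← hopp, sub_add_eq_sub_sub]
  obtain ⟨a, ha⟩ : ∃ a, f a < 0 := by
    obtain ⟨j, hj⟩ := hC
    have h2 : f j ≠ 0 := hne j
    have h3 : f (j + t) ≠ 0 := hne (j + t)
    have h4 := hanti j
    rw [if_neg hj] at h4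
    by_contra! hpos
    have h5 := hpos j
    have h6 := hpos (j + t)
    split_ifs at h4 <;> omega
  have hcross (j : ZMod m) (hj : f j < 0) : f (j + 1) < 0 := by
    have h2 : f (j + 1) ≠ 0 := hne (j + 1)
    have h3 : f (j + 1 + t) ≠ 0 := hne (j + 1 + t)
    have h4 := hstep j
    have h5 := hanti (j + 1)
    rw [show j + ((t : ZMod m) + 1) = j + 1 + t by ring] at h4
    split_ifs at h4 h5 <;> omega
  have hneg (l : ℕ) : f (a + l) < 0 := by
    induction l with
    | zero => simpa using ha
    | succ l ih => rw [Nat.cast_succ, ← add_assoc]; exact hcross _ ih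
  have h2 := hneg t
  have h3 := hanti a
  split_ifs at h3 <;> omega

/-- A sign pattern on the cycle of length `d + 1`, vanishing exactly at `0`, some translate of
which balances any prescribed nonempty set (any proper one if `d` is odd). -/
lemma exists_balancing_pattern {d : ℕ} (hd : 2 ≤ d) :
    ∃ w : ZMod (d + 1) → ℤ, (∀ k, w k = -1 ∨ w k = 0 ∨ w k = 1) ∧ (∀ k, w k = 0 ↔ k = 0) ∧
      ∀ C : Finset (ZMod (d + 1)), (Odd d → C.card ≤ d) → ∃ j, ∑ i ∈ C, w (i - j) = 0 := by
  rcases Nat.even_or_odd d with h | h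
  · refine ⟨alternatingPattern, fun k => ?_, fun k => ?_, fun C _ =>
      exists_alternatingPattern_sum_eq_zero h.add_one (by omega) C⟩
    · unfold alternatingPattern; split_ifs <;> simp
    · rw [← ZMod.val_eq_zero]; unfold alternatingPattern; split_ifs <;> simp_all
  · obtain ⟨s, hs⟩ := h
    refine ⟨blockPattern (s + 1), fun k => ?_, fun k => ?_, fun C hC =>
      exists_blockPattern_sum_eq_zero (by omega) (by omega) C ?_⟩
    · unfold blockPattern; split_ifs <;> simp
    · rw [← ZMod.val_eq_zero]; unfold blockPattern; split_ifs <;> simp_all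
    · by_contra! hall
      have := hC ⟨s, hs⟩
      rw [Finset.eq_univ_iff_forall.2 hall, Finset.card_univ, ZMod.card] at this
      omega

lemma bisects_of_sum_eq_zero {n : ℕ} {X : Fin n → ℤ} {B : Finset (Fin n)}
    (hX : ∀ i, X i = -1 ∨ X i = 0 ∨ X i = 1) (hsum : ∑ i ∈ B, X i = 0)
    (hne : ∃ i ∈ B, X i ≠ 0) : Bisects X B := by
  have hdiff : ∑ i ∈ B, X i = ((B.filter fun i => X i = 1).card : ℤ) -
      (B.filter fun i => X i = -1).card := by
    rw [Finset.card_filter, Finset.card_filter]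
    push_cast
    rw [← Finset.sum_sub_distrib]
    refine Finset.sum_congr rfl fun i _ => ?_
    rcases hX i with h | h | h <;> simp [h]
  have heq : (B.filter fun i => X i = 1).card = (B.filter fun i => X i = -1).card := by omega
  refine ⟨heq, fun h0 => ?_⟩
  obtain ⟨i, hi, hXi⟩ := hne
  have hp := Finset.card_eq_zero.1 h0
  have hm := Finset.card_eq_zero.1 (heq ▸ h0)
  rcases hX i with h | h | h
  · exact Finset.notMem_empty i (hm ▸ Finset.mem_filter.2 ⟨hi, h⟩)
  · exact hXi h
  · exact Finset.notMem_empty i (hp ▸ Finset.mem_filter.2 ⟨hi, h⟩)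

/-- On a `(d + 1)`-element set `A` there are `d + 1` bicolorings of order `d` bisecting every
set which meets `A` in at least two points, and in at most `d` points if `d` is odd. -/
lemma exists_bicolorings_of_card_eq_add_one {n d : ℕ} (hd : 2 ≤ d) {A : Finset (Fin n)}
    (hA : A.card = d + 1) :
    ∃ 𝒳 : Finset (Fin n → ℤ), 𝒳.card ≤ d + 1 ∧ (∀ X ∈ 𝒳, IsBicoloring d X) ∧
      ∀ B : Finset (Fin n), 2 ≤ (B ∩ A).card → (Odd d → (B ∩ A).card ≤ d) →
        ∃ X ∈ 𝒳, Bisects X B := by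
  obtain ⟨w, hw, hw0, hbal⟩ := exists_balancing_pattern hd
  obtain ⟨e⟩ : Nonempty (ZMod (d + 1) ≃ A) := by
    rw [← Fintype.card_eq, ZMod.card, Fintype.card_coe, hA]
  set g : ZMod (d + 1) → Fin n := fun k => e k with hg
  have hinj : Function.Injective g := Subtype.val_injective.comp e.injective
  have himg (v : Fin n) : v ∈ A ↔ ∃ k, g k = v :=
    ⟨fun h => ⟨e.symm ⟨v, h⟩, by simp [hg]⟩, by rintro ⟨k, rfl⟩; exact (e k).2⟩
  set X : ZMod (d + 1) → Fin n → ℤ := fun j => Function.extend g (fun k => w (k - j)) 0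
  have hXg (j k) : X j (g k) = w (k - j) := hinj.extend_apply _ _ _
  have hXout (j v) (hv : v ∉ A) : X j v = 0 :=
    Function.extend_apply' _ _ _ fun h => hv ((himg v).2 h)
  have hXval (j v) : X j v = -1 ∨ X j v = 0 ∨ X j v = 1 := by
    by_cases hv : v ∈ A
    · obtain ⟨k, rfl⟩ := (himg v).1 hv
      rw [hXg]; exact hw _
    · exact Or.inr (Or.inl (hXout j v hv))
  have hXne (j v) : X j v ≠ 0 ↔ v ∈ A.erase (g j) := by
    by_cases hv : v ∈ A
    · obtain ⟨k, rfl⟩ := (himg v).1 hv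
      rw [hXg, Ne, hw0, sub_eq_zero, Finset.mem_erase, Ne, hinj.eq_iff]
      tauto
    · simp [hXout j v hv, hv]
  refine ⟨Finset.univ.image X, ?_, ?_, fun B h2 hodd => ?_⟩
  · exact Finset.card_image_le.trans (by rw [Finset.card_univ, ZMod.card])
  · simp only [Finset.mem_image, Finset.mem_univ, true_and, forall_exists_index,
      forall_apply_eq_imp_iff]
    refine fun j => ⟨hXval j, ?_⟩
    simp only [hXne]
    rw [Finset.filter_univ_mem, Finset.card_erase_of_mem ((himg _).2 ⟨j, rfl⟩), hA]
    rfl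
  · set C : Finset (ZMod (d + 1)) := Finset.univ.filter fun k => g k ∈ B with hC
    have hCB : C.image g = B ∩ A := by
      ext v
      simp only [hC, Finset.mem_image, Finset.mem_filter, Finset.mem_univ, true_and,
        Finset.mem_inter, himg]
      constructor
      · rintro ⟨k, hk, rfl⟩; exact ⟨hk, k, rfl⟩
      · rintro ⟨hv, k, rfl⟩; exact ⟨k, hv, rfl⟩
    have hCcard : C.card = (B ∩ A).card := by
      rw [← hCB, Finset.card_image_of_injective _ hinj]
    obtain ⟨j, hj⟩ := hbal C (by rwa [hCcard])
    refine ⟨X j, Finset.mem_image_of_mem _ (Finset.mem_univ j),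
      bisects_of_sum_eq_zero (hXval j) ?_ ?_⟩
    · rw [← hj, ← Finset.sum_subset (Finset.inter_subset_left (s₁ := B) (s₂ := A)), ← hCB,
        Finset.sum_image hinj.injOn]
      · simp only [hXg]
      · intro v hv hv'
        exact hXout j v fun h => hv' (Finset.mem_inter.2 ⟨hv, h⟩)
    · obtain ⟨v, hv, hvj⟩ := Finset.exists_mem_ne h2 (g j)
      rw [Finset.mem_inter] at hv
      exact ⟨v, hv.1, (hXne j v).2 (Finset.mem_erase.2 ⟨hvj, hv.2⟩)⟩

/-- If every hyperedge `B` of a hypergraph `H` on `[n]` meets some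
`(d+1)`-element set `A` of a family `F` with `|B ∩ A| ≥ 2` (when `d` even), resp.
`2 ≤ |B ∩ A| ≤ d` (when `d` odd), then `H` has an induced-bisecting family of order `d`
of cardinality at most `|F|·(d+1)`. -/
theorem ibf_from_intersecting_family (n d : ℕ) (hd : 2 ≤ d) (hdn : d ≤ n)
    (E : Finset (Finset (Fin n))) (F : Finset (Finset (Fin n)))
    (hF : ∀ A ∈ F, A.card = d + 1)
    (hcov : ∀ B ∈ E, ∃ A ∈ F,
      (Even d → 2 ≤ (B ∩ A).card) ∧
      (Odd d → 2 ≤ (B ∩ A).card ∧ (B ∩ A).card ≤ d)) :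
    ∃ 𝒳 : Finset (Fin n → ℤ), IsIBF d E 𝒳 ∧ 𝒳.card ≤ F.card * (d + 1) := by
  classical
  choose! G hcard hbic hbis using
    fun (A : Finset (Fin n)) (hA : A ∈ F) => exists_bicolorings_of_card_eq_add_one hd (hF A hA)
  refine ⟨F.biUnion G, ⟨fun X hX => ?_, fun B hB _ _ => ?_⟩,
    Finset.card_biUnion_le_card_mul _ _ _ hcard⟩
  · obtain ⟨A, hA, hXA⟩ := Finset.mem_biUnion.1 hX
    exact hbic A hA X hXA
  · obtain ⟨A, hA, heven, hodd⟩ := hcov B hB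
    obtain ⟨X, hX, hXB⟩ := hbis A hA B
      ((Nat.even_or_odd d).elim heven fun h => (hodd h).1) fun h => (hodd h).2
    exact ⟨X, Finset.mem_biUnion.2 ⟨A, hA, hX⟩, hXB⟩
end

section
/- Let n be odd and let σ be any circular permutation of [n]. For any subset A ⊆ [n] of odd size k, let (a₀,…,a_{k-1}) be the ordering of the elements of A in clockwise order with respect to σ. Then there exists an index i ∈ {0,…,k-1} such that dist_σ(a_i, a_{i+⌊k/2⌋}) < n/2 and dist_σ(a_{i+⌊k/2⌋+1}, a_i) < n/2, where the subscript addition is modulo k. -/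
open Finset

/-- The clockwise distance from `x` to `y` in the circular arrangement of `[n]` given by
the permutation `σ` (where `σ p` is the element placed at position `p`): it is the number
of clockwise steps from `x` to `y`, i.e. one more than the number of elements lying
strictly between `x` and `y` in the clockwise direction. -/
def cdist {n : ℕ} (σ : Equiv.Perm (Fin n)) (x y : Fin n) : ℕ :=
  (σ.symm y - σ.symm x).val

theorem cdist_of_le {n : ℕ} (σ : Equiv.Perm (Fin n)) {x y : Fin n}
    (h : (σ.symm x : ℕ) ≤ σ.symm y) : cdist σ x y = σ.symm y - σ.symm x :=
  Fin.sub_val_of_le h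

theorem cdist_of_lt {n : ℕ} (σ : Equiv.Perm (Fin n)) {x y : Fin n}
    (h : (σ.symm y : ℕ) < σ.symm x) : cdist σ x y = n + σ.symm y - σ.symm x :=
  Fin.coe_sub_iff_lt.2 h

/-- For positions `p 0 ≤ ⋯ ≤ p (2 * m)` on a circle of odd length `n`, some index has fewer than
`n / 2` steps both to the position `m` places ahead and from the position `m` places behind.
In the three alternatives this index is `m`, some `i < m`, and `i + m + 1` with `i < m`. -/
theorem exists_median_index {n m : ℕ} (hn : Odd n) {p : ℕ → ℕ}
    (hp : ∀ i j, i ≤ j → j ≤ 2 * m → p i ≤ p j) (hlt : p (2 * m) < n) :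
    (2 * (p m - p 0) < n ∧ 2 * (p (2 * m) - p m) < n) ∨
      (∃ i < m, 2 * (p (i + m) - p i) < n ∧ n < 2 * (p (i + m + 1) - p i)) ∨
      ∃ i < m, n < 2 * (p (i + m + 1) - p i) ∧ 2 * (p (i + m + 1) - p (i + 1)) < n := by
  obtain ⟨t, rfl⟩ := hn
  by_contra! ⟨h₀, h₁, h₂⟩
  have step : ∀ i < m, (2 * (p (i + m) - p i) < 2 * t + 1 ↔
      2 * (p (i + m + 1) - p (i + 1)) < 2 * t + 1) := by
    intro i hi
    have := h₁ i hi
    have := h₂ i hi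
    have := hp i (i + 1) (by lia) (by lia)
    have := hp (i + m) (i + m + 1) (by lia) (by lia)
    lia
  have all : ∀ i ≤ m, (2 * (p m - p 0) < 2 * t + 1 ↔ 2 * (p (i + m) - p i) < 2 * t + 1) := by
    intro i
    induction i with
    | zero => simp
    | succ i ih =>
      intro hi
      rw [ih (by lia), step i hi, add_right_comm]
  have last := all m le_rfl
  rw [← two_mul] at last
  have := hp 0 m (by lia) (by lia)
  have := hp m (2 * m) (by lia) le_rfl
  lia

/-- Let `n` be odd, `σ` a circular permutation of `[n]`, and `A ⊆ [n]` of odd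
size `k` with clockwise ordering `a₀, …, a_{k-1}`. Then there is an index `i` such that
`dist_σ(a_i, a_{i+⌊k/2⌋}) < n/2` and `dist_σ(a_{i+⌊k/2⌋+1}, a_i) < n/2` (indices mod `k`). -/
theorem circular_median_index (n : ℕ) (hn : Odd n) (σ : Equiv.Perm (Fin n))
    (A : Finset (Fin n)) (k : ℕ) (hk : A.card = k) (hkodd : Odd k)
    (a : Fin k → Fin n) (hmem : ∀ i, a i ∈ A) (hinj : Function.Injective a)
    (hmono : StrictMono fun i => σ.symm (a i)) :
    ∃ i : Fin k,
      2 * cdist σ (a i) (a ⟨((i : ℕ) + k / 2) % k, Nat.mod_lt _ hkodd.pos⟩) < n ∧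
      2 * cdist σ (a ⟨((i : ℕ) + k / 2 + 1) % k, Nat.mod_lt _ hkodd.pos⟩) (a i) < n := by
  obtain ⟨m, rfl⟩ := hkodd
  have half : (2 * m + 1) / 2 = m := by lia
  let p : ℕ → ℕ := fun i => σ.symm (a ⟨i % (2 * m + 1), Nat.mod_lt _ (by lia)⟩)
  have eval : ∀ i (hi : i < 2 * m + 1), (σ.symm (a ⟨i, hi⟩) : ℕ) = p i := by
    intro i hi
    simp only [p, Nat.mod_eq_of_lt hi]
  have hp : ∀ i j, i ≤ j → j ≤ 2 * m → p i ≤ p j := by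
    intro i j hij hj
    rw [← eval i (by lia), ← eval j (by lia)]
    exact hmono.monotone (Fin.mk_le_mk.2 hij)
  have dist_le : ∀ i j (hi : i < 2 * m + 1) (hj : j < 2 * m + 1), i ≤ j →
      cdist σ (a ⟨i, hi⟩) (a ⟨j, hj⟩) = p j - p i := by
    intro i j hi hj hij
    rw [cdist_of_le σ (hmono.monotone (Fin.mk_le_mk.2 hij)), eval, eval]
  have dist_lt : ∀ i j (hi : i < 2 * m + 1) (hj : j < 2 * m + 1), j < i →
      cdist σ (a ⟨i, hi⟩) (a ⟨j, hj⟩) = n + p j - p i := by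
    intro i j hi hj hij
    rw [cdist_of_lt σ (hmono (Fin.mk_lt_mk.2 hij)), eval, eval]
  have hlt : ∀ i, p i < n := fun i => Fin.isLt _
  simp only [half]
  rcases exists_median_index hn hp (hlt _) with ⟨h₁, h₂⟩ | ⟨i, hi, h₁, h₂⟩ | ⟨i, hi, h₁, h₂⟩
  · refine ⟨⟨m, by lia⟩, ?_⟩
    have e₁ : (m + m) % (2 * m + 1) = 2 * m := by
      rw [Nat.mod_eq_of_lt (by lia)]; lia
    have e₂ : (m + m + 1) % (2 * m + 1) = 0 := by
      rw [← two_mul, Nat.mod_self]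
    simp only [e₁, e₂]
    rw [dist_le _ _ _ _ (by lia), dist_le _ _ _ _ (by lia)]
    exact ⟨h₂, h₁⟩
  · refine ⟨⟨i, by lia⟩, ?_⟩
    have e₁ : (i + m) % (2 * m + 1) = i + m := Nat.mod_eq_of_lt (by lia)
    have e₂ : (i + m + 1) % (2 * m + 1) = i + m + 1 := Nat.mod_eq_of_lt (by lia)
    simp only [e₁, e₂]
    rw [dist_le _ _ _ _ (by lia), dist_lt _ _ _ _ (by lia)]
    have := hlt (i + m + 1)
    lia
  · refine ⟨⟨i + m + 1, by lia⟩, ?_⟩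
    have e₁ : (i + m + 1 + m) % (2 * m + 1) = i := by
      rw [show i + m + 1 + m = i + (2 * m + 1) by lia, Nat.add_mod_right,
        Nat.mod_eq_of_lt (by lia)]
    have e₂ : (i + m + 1 + m + 1) % (2 * m + 1) = i + 1 := by
      rw [show i + m + 1 + m + 1 = i + 1 + (2 * m + 1) by lia, Nat.add_mod_right,
        Nat.mod_eq_of_lt (by lia)]
    simp only [e₁, e₂]
    rw [dist_lt _ _ _ _ (by lia), dist_le _ _ _ _ (by lia)]
    have := hlt (i + m + 1)
    lia
end

section
/- For every integer n ≥ 2, β²(n) = C(n,2), the binomial coefficient 'n choose 2'. That is, the minimum cardinality of a set 𝒱 of vectors in {-1,0,1}ⁿ, each with exactly 2 nonzero entries, such that every point of {0,1}ⁿ other than the zero vector and the standard unit vectors is non-trivially orthogonal to some V ∈ 𝒱, equals n(n-1)/2. -/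
open Finset

/-- The supports of a family covering the cube with `2`-sparse vectors exhaust all pairs. -/
lemma IsCovering.choose_two_le_card {n : ℕ} {𝒱 : Finset (Fin n → ℤ)} (h : IsCovering n 2 𝒱) :
    n.choose 2 ≤ 𝒱.card := by
  have hsub : powersetCard 2 (univ : Finset (Fin n)) ⊆
      𝒱.image fun V => univ.filter fun i => V i ≠ 0 := by
    intro s hs
    have hs2 : s.card = 2 := (mem_powersetCard.1 hs).2
    obtain ⟨i, j, hij, rfl⟩ := card_eq_two.1 hs2
    obtain ⟨V, hV, hsum, hnt⟩ := h.2 (fun x => if x ∈ ({i, j} : Finset (Fin n)) then 1 else 0)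
      (fun x => by grind) (by
        rintro (h0 | ⟨k, hk⟩ | ⟨h2, -⟩)
        · simpa using h0 i
        · have hi := hk i
          have hj := hk j
          grind
        · exact absurd h2 (by decide))
    simp only [ite_mul, one_mul, zero_mul, sum_ite_mem, univ_inter, sum_pair hij] at hsum
    have hne : V i ≠ 0 ∧ V j ≠ 0 := by
      by_contra hc
      apply hnt
      intro x
      by_cases hxi : x = i
      · subst hxi; right; omega
      by_cases hxj : x = j
      · subst hxj; right; omega
      left
      simp [hxi, hxj]
    refine mem_image.2 ⟨V, hV, (eq_of_subset_of_card_le ?_ ?_).symm⟩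
    · intro x hx
      rcases mem_insert.1 hx with rfl | hx
      · simpa using hne.1
      · rw [mem_singleton.1 hx]
        simpa using hne.2
    · rw [(h.1 V hV).2, hs2]
  calc n.choose 2 = (powersetCard 2 (univ : Finset (Fin n))).card := by simp
    _ ≤ _ := card_le_card hsub
    _ ≤ 𝒱.card := card_image_le

/-- The vector supported on `s` with value `1` at the least element of `s` and `-1` at the others. -/
def leastSignVec {n : ℕ} (s : Finset (Fin n)) (i : Fin n) : ℤ :=
  if i ∈ s then if ∀ j ∈ s, i ≤ j then 1 else -1 else 0

lemma leastSignVec_ne_zero_iff {n : ℕ} {s : Finset (Fin n)} {i : Fin n} :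
    leastSignVec s i ≠ 0 ↔ i ∈ s := by
  unfold leastSignVec
  split_ifs <;> simp_all

lemma exists_pair_of_not_trivialPt {n d : ℕ} {A : Fin n → ℤ} (hA : IsCubePt A)
    (hnt : ¬ TrivialPt d A) : ∃ i j, i < j ∧ A i = 1 ∧ A j = 1 := by
  have h0 : ∃ i, A i ≠ 0 := by
    by_contra! hc
    exact hnt (Or.inl hc)
  obtain ⟨i, hi⟩ := h0
  have hi1 : A i = 1 := (hA i).resolve_left hi
  have h1 : ∃ j, j ≠ i ∧ A j = 1 := by
    by_contra! hc
    refine hnt (Or.inr (Or.inl ⟨i, fun j => ?_⟩))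
    split_ifs with hj
    · rw [hj, hi1]
    · exact (hA j).resolve_right (hc j hj)
  obtain ⟨j, hji, hj1⟩ := h1
  rcases lt_or_gt_of_ne hji with hlt | hlt
  · exact ⟨j, i, hlt, hj1, hi1⟩
  · exact ⟨i, j, hlt, hi1, hj1⟩

lemma isCovering_image_leastSignVec (n : ℕ) :
    IsCovering n 2 ((powersetCard 2 univ).image leastSignVec) := by
  constructor
  · intro V hV
    obtain ⟨s, hs, rfl⟩ := mem_image.1 hV
    refine ⟨fun i => ?_, ?_⟩
    · unfold leastSignVec
      split_ifs <;> simp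
    · simp only [leastSignVec_ne_zero_iff, filter_univ_mem]
      exact (mem_powersetCard.1 hs).2
  · intro A hA hnt
    obtain ⟨i, j, hij, hi, hj⟩ := exists_pair_of_not_trivialPt hA hnt
    refine ⟨leastSignVec {i, j}, mem_image_of_mem _ (by simp [mem_powersetCard, card_pair hij.ne]),
      ?_, fun ht => ?_⟩
    · rw [← sum_subset (subset_univ {i, j}), sum_pair hij.ne]
      · simp [leastSignVec, hi, hj, hij.le, hij.not_ge]
      · intro x _ hx
        simp only [leastSignVec, if_neg hx, mul_zero]
    · rcases ht i with h | h
      · simp [hi] at h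
      · exact leastSignVec_ne_zero_iff.2 (mem_insert_self i {j}) h

/-- For every integer `n ≥ 2`, `β²(n) = C(n,2)`. -/
theorem beta_two (n : ℕ) (hn : 2 ≤ n) :
    beta n 2 = Nat.choose n 2 := by
  apply le_antisymm
  · calc beta n 2 ≤ ((powersetCard 2 univ).image (leastSignVec (n := n))).card :=
          Nat.sInf_le ⟨_, rfl, isCovering_image_leastSignVec n⟩
      _ ≤ (powersetCard 2 (univ : Finset (Fin n))).card := card_image_le
      _ = n.choose 2 := by simp
  · refine le_csInf ⟨_, _, rfl, isCovering_image_leastSignVec n⟩ ?_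
    rintro _ ⟨𝒱, rfl, h⟩
    exact h.choose_two_le_card
end

section
/- For all integers n and d with 2 ≤ d ≤ n, β^d(n) ≤ C(⌈2(n-1)/(d-1)⌉, 2) + ⌈(n-1)/(d-1)⌉·d, where C(m,2) denotes the binomial coefficient 'm choose 2'. -/
open Finset

/-- The support of `A` contains at least two points of `S`. -/
def MeetsTwice {n : ℕ} (A : Fin n → ℤ) (S : Finset (Fin n)) : Prop :=
  ∃ i ∈ S, ∃ j ∈ S, i ≠ j ∧ A i = 1 ∧ A j = 1

theorem MeetsTwice.mono {n : ℕ} {A : Fin n → ℤ} {S T : Finset (Fin n)} (h : MeetsTwice A S)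
    (hST : S ⊆ T) : MeetsTwice A T := by
  obtain ⟨i, hi, j, hj, h⟩ := h
  exact ⟨i, hST hi, j, hST hj, h⟩

theorem exists_step {p : ℕ → Prop} {s t : ℕ} (hst : s ≤ t) (hs : ¬ p s) (ht : p t) :
    ∃ r, ¬ p r ∧ p (r + 1) := by
  by_contra! h
  induction t, hst using Nat.le_induction with
  | base => exact hs ht
  | succ k _ ih => exact ih (by by_contra hk; exact h k hk ht)

/-- A periodic sequence of odd period that almost changes sign at each step vanishes somewhere,
and takes both values `1` and `-1` as soon as the steps are not all exact sign changes. -/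
theorem periodic_alternating_values {f a : ℕ → ℤ} {m : ℕ} (hm : Odd m)
    (hf : ∀ t, f (t + m) = f t) (ha01 : ∀ t, a t = 0 ∨ a t = 1)
    (hfa : ∀ t, f t + f (t + 1) = a t - a (t + 1)) :
    (∃ t, f t = 0) ∧
      ((∃ s s', a s ≠ a s') → (∃ t, f t = 1) ∧ ∃ t, f t = -1) := by
  have hpar : ∀ t, (f t + a t) % 2 = (f 0 + a 0) % 2 := by
    intro t
    induction t with
    | zero => rfl
    | succ t ih => have := hfa t; omega
  have hfk : ∀ k t, f (t + m * k) = f t := by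
    intro k
    induction k with
    | zero => simp
    | succ k ih => intro t; rw [Nat.mul_succ, ← add_assoc, hf, ih]
  have hmpos : 0 < m := hm.pos
  have hzero : ∃ t, f t = 0 := by
    by_contra! h
    have hsign : ∀ t, (0 < f t ↔ (if Even t then 0 < f 0 else f 0 < 0)) := by
      intro t
      induction t with
      | zero => simp
      | succ t ih =>
        have h1 := hfa t
        have h2 := ha01 t
        have h3 := ha01 (t + 1)
        have h4 := h t
        have h5 := h (t + 1)
        have h6 := h 0
        by_cases ht : Even t
        · simp only [ht, if_true] at ih
          simp only [Nat.even_add_one, ht, not_true, if_false]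
          omega
        · simp only [ht, if_false] at ih
          simp only [Nat.even_add_one, ht, not_false_iff, if_true]
          omega
    have h1 := hsign m
    have h2 := hf 0
    have h3 := h 0
    simp only [Nat.not_even_iff_odd.2 hm, if_false] at h1
    rw [zero_add] at h2
    omega
  refine ⟨hzero, ?_⟩
  rintro ⟨s, s', hss⟩
  obtain ⟨t, ht⟩ := hzero
  have hne : ∃ r, f r ≠ 0 := by
    by_contra! h
    have h1 := hpar s
    have h2 := hpar s'
    rw [h] at h1 h2
    have h3 := ha01 s
    have h4 := ha01 s'
    omega
  obtain ⟨r, hr⟩ := hne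
  obtain ⟨u, hu, hu'⟩ := exists_step (p := fun t => f t = 0) (s := r) (t := t + m * r)
    (by nlinarith) hr (by rw [hfk]; exact ht)
  obtain ⟨v, hv, hv'⟩ := exists_step (p := fun t => f t ≠ 0) (s := t) (t := r + m * t)
    (by nlinarith) (not_not.2 ht) (by rw [hfk]; exact hr)
  simp only [not_not] at hv
  have e1 := hfa u
  have e2 := hfa v
  have p1 := hpar (u + 1)
  have p2 := hpar v
  have a1 := ha01 u
  have a2 := ha01 (u + 1)
  have a3 := ha01 v
  have a4 := ha01 (v + 1)
  have hcase : (f u = 1 ∧ f (v + 1) = -1) ∨ (f u = -1 ∧ f (v + 1) = 1) := by omega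
  rcases hcase with ⟨h1, h2⟩ | ⟨h1, h2⟩
  · exact ⟨⟨_, h1⟩, ⟨_, h2⟩⟩
  · exact ⟨⟨_, h2⟩, ⟨_, h1⟩⟩

/-- Alternating signs around a cycle of length `m`, starting after a zero at `0`. -/
def alternating {m : ℕ} (k : ZMod m) : ℤ := if k = 0 then 0 else (-1) ^ k.val

theorem alternating_eq_zero {m : ℕ} {k : ZMod m} : alternating k = 0 ↔ k = 0 := by
  unfold alternating
  split_ifs with h <;> simp [h]

theorem alternating_values {m : ℕ} (k : ZMod m) :
    alternating k = -1 ∨ alternating k = 0 ∨ alternating k = 1 := by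
  unfold alternating
  split_ifs with h
  · simp
  · rcases neg_one_pow_eq_or ℤ k.val with h | h <;> simp [h]

theorem alternating_add_sub_one {m : ℕ} (hm : Odd m) (k : ZMod m) :
    alternating k + alternating (k - 1) =
      (if k = 0 then 1 else 0) - (if k = 1 then 1 else 0) := by
  obtain ⟨q, rfl⟩ : ∃ q, m = q + 1 := ⟨m - 1, by have := hm.pos; omega⟩
  have hval : (k - 1).val = if k = 0 then q else k.val - 1 :=
    Fin.coe_sub_one k
  unfold alternating
  by_cases h0 : k = 0
  · subst h0
    have hq : Even q := by
      rcases hm with ⟨r, hr⟩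
      exact ⟨r, by omega⟩
    by_cases h1 : (0 : ZMod (q + 1)) = 1
    · simp [← h1]
    · have : (0 : ZMod (q + 1)) - 1 ≠ 0 := by rw [sub_ne_zero]; exact h1
      simp only [this, h1, if_true, if_false, hval, hq.neg_one_pow]
      simp
  · by_cases h1 : k = 1
    · subst h1
      rcases q with _ | q
      · exact absurd (Subsingleton.elim (α := Fin 1) _ _) h0
      have : (1 : ZMod (q + 1 + 1)).val = 1 := ZMod.val_one'' (by omega)
      simp [h0, this]
    · have h2 : k - 1 ≠ 0 := by rw [sub_ne_zero]; exact h1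
      have h3 : 0 < k.val := Nat.pos_of_ne_zero (by simpa using h0)
      obtain ⟨v, hv⟩ : ∃ v, k.val = v + 1 := ⟨k.val - 1, by omega⟩
      simp only [h0, h1, h2, if_false, hval, hv]
      simp [pow_succ]

/-- Rotating an alternating vector on an odd set `Q`, padded by the fixed vector `P`. -/
theorem exists_rotation_family {n d m : ℕ} (Q : Finset (Fin n)) (P : Fin n → ℤ)
    (hQ : #Q = m) (hm : Odd m) (hP : ∀ i, P i = -1 ∨ P i = 0 ∨ P i = 1)
    (hPQ : ∀ i ∈ Q, P i = 0) (hcard : #{i | P i ≠ 0} + m = d + 1) :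
    ∃ F : Finset (Fin n → ℤ), #F ≤ m ∧ (∀ V ∈ F, IsSignVec d V) ∧
      ∀ A, IsCubePt A → MeetsTwice A Q →
        (∑ i, A i * P i = 0 ∨
          (∑ i, A i * P i = 1 ∨ ∑ i, A i * P i = -1) ∧ ∃ i ∈ Q, A i = 0) →
        ∃ V ∈ F, NonTrivOrth A V := by
  classical
  have : NeZero m := ⟨hm.pos.ne'⟩
  have e : {i // i ∈ Q} ≃ ZMod m :=
    Fintype.equivOfCardEq (by rw [Fintype.card_coe, hQ, ZMod.card])
  let V : ZMod m → Fin n → ℤ := fun t i =>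
    if h : i ∈ Q then alternating (e ⟨i, h⟩ - t) else P i
  have hVP : ∀ t, ∀ i ∉ Q, V t i = P i := fun t i hi => dif_neg hi
  have hVe : ∀ t k, V t (e.symm k) = alternating (k - t) := by
    intro t k
    simp [V]
  refine ⟨Finset.univ.image V, ?_, ?_, ?_⟩
  · exact Finset.card_image_le.trans (by simp [ZMod.card])
  · intro W hW
    obtain ⟨t, -, rfl⟩ := Finset.mem_image.1 hW
    constructor
    · intro i
      by_cases hi : i ∈ Q
      · simpa only [V, hi, dif_pos] using alternating_values _
      · rw [hVP t i hi]; exact hP i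
    · have hset : (Finset.univ.filter fun i => V t i ≠ 0) =
          Q.erase (e.symm t) ∪ Finset.univ.filter (fun i => P i ≠ 0) := by
        ext i
        simp only [mem_filter, mem_univ, true_and, mem_union, mem_erase]
        by_cases hi : i ∈ Q
        · have h1 : i = e.symm t ↔ e ⟨i, hi⟩ - t = 0 := by
            rw [sub_eq_zero, ← Equiv.eq_symm_apply, Subtype.ext_iff]
          simp only [V, hi, dif_pos, hPQ i hi, Ne, alternating_eq_zero, h1]
          simp
        · simp [hVP t i hi, hi]
      rw [hset, Finset.card_union_of_disjoint, Finset.card_erase_of_mem (e.symm t).2]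
      · have := hm.pos
        omega
      · rw [Finset.disjoint_left]
        intro i hi hi'
        exact (Finset.mem_filter.1 hi').2 (hPQ i (Finset.mem_of_mem_erase hi))
  · intro A hA hAQ hAP
    let a : ZMod m → ℤ := fun k => A (e.symm k)
    let f : ZMod m → ℤ := fun t => ∑ k, a (k + t) * alternating k
    have hsum : ∀ t, ∑ i, A i * V t i = f t + ∑ i, A i * P i := by
      intro t
      have h1 : ∀ g : Fin n → ℤ, ∑ i, g i = ∑ i ∈ Q, g i + ∑ i ∈ Qᶜ, g i := fun g =>
        (Finset.sum_add_sum_compl Q g).symm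
      rw [h1, h1 fun i => A i * P i, Finset.sum_eq_zero (s := Q) (f := fun i => A i * P i)
        (fun i hi => by rw [hPQ i hi, mul_zero]), zero_add]
      congr 1
      · rw [← Finset.sum_coe_sort Q, ← Equiv.sum_comp e.symm]
        rw [← Equiv.sum_comp (Equiv.addRight t)]
        refine Finset.sum_congr rfl fun k _ => ?_
        rw [hVe]
        simp [a]
      · exact Finset.sum_congr rfl fun i hi => by rw [hVP t i (Finset.mem_compl.1 hi)]
    have hrel : ∀ t, f t + f (t + 1) = a t - a (t + 1) := by
      intro t
      have h1 : f (t + 1) = ∑ k, a (k + t) * alternating (k - 1) := by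
        rw [← Equiv.sum_comp (Equiv.addRight (1 : ZMod m))]
        refine Finset.sum_congr rfl fun k _ => ?_
        simp [add_assoc, add_comm t 1]
      rw [h1, ← Finset.sum_add_distrib]
      simp_rw [← mul_add, alternating_add_sub_one hm, mul_sub, Finset.sum_sub_distrib, mul_ite,
        mul_one, mul_zero, Finset.sum_ite_eq' Finset.univ, Finset.mem_univ, if_true]
      rw [zero_add, add_comm 1 t]
    obtain ⟨h0, h1⟩ := periodic_alternating_values (f := fun t => f t) (a := fun t => a t) hm
      (by simp) (fun t => hA _) (fun t => by simpa using hrel t)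
    have hhit : ∀ t, f t + ∑ i, A i * P i = 0 → ∃ W ∈ Finset.univ.image V, NonTrivOrth A W := by
      intro t ht
      refine ⟨V t, Finset.mem_image_of_mem _ (Finset.mem_univ _), by rw [hsum, ht], ?_⟩
      intro htriv
      have hone : ∀ i ∈ Q, A i = 1 → i = e.symm t := by
        intro i hi hAi
        have h2 := htriv i
        rw [hAi] at h2
        simp only [one_ne_zero, false_or, V, hi, dif_pos, alternating_eq_zero] at h2
        rw [← sub_eq_zero.1 h2]
        simp
      obtain ⟨i, hi, j, hj, hij, hAi, hAj⟩ := hAQ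
      exact hij ((hone i hi hAi).trans (hone j hj hAj).symm)
    rcases hAP with hz | ⟨hpm, j, hj, hAj⟩
    · obtain ⟨t, ht⟩ := h0
      exact hhit t (by rw [ht, hz, add_zero])
    · obtain ⟨i, hi, -, -, -, hAi, -⟩ := hAQ
      obtain ⟨⟨t, ht⟩, ⟨s, hs⟩⟩ := h1 ⟨(e ⟨i, hi⟩).val, (e ⟨j, hj⟩).val, by simp [a, hAi, hAj]⟩
      rcases hpm with h | h
      · exact hhit s (by rw [hs, h]; norm_num)
      · exact hhit t (by rw [ht, h]; norm_num)

/-- A single vector separating a point of `P` from a point of `R`. -/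
theorem exists_separating_vector {n d : ℕ} {P C R : Finset (Fin n)} (hPC : P ⊆ C) (hC : #C = d)
    (hCR : Disjoint C R) (hPR : #P + #R ≤ d) :
    ∃ V : Fin n → ℤ, IsSignVec d V ∧ ∀ A, IsCubePt A → ¬ MeetsTwice A C → ¬ MeetsTwice A R →
      (∃ i ∈ P, A i = 1) → (∃ j ∈ R, A j = 1) → NonTrivOrth A V := by
  classical
  obtain ⟨T, hPT, hTC, hT⟩ := Finset.exists_subsuperset_card_eq hPC (n := d - #R)
    (by omega) (by omega)
  have hTR : Disjoint T R := hCR.mono_left hTC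
  have hsub : ∀ {A : Fin n → ℤ} {S : Finset (Fin n)} {i : Fin n}, IsCubePt A →
      ¬ MeetsTwice A S → i ∈ S → A i = 1 → ∑ j ∈ S, A j = 1 := by
    intro A S i hA hS hi hAi
    rw [Finset.sum_eq_single_of_mem i hi, hAi]
    intro j hj hji
    by_contra hAj
    exact hS ⟨j, hj, i, hi, hji, (hA j).resolve_left hAj, hAi⟩
  refine ⟨fun i => if i ∈ T then 1 else if i ∈ R then -1 else 0, ⟨?_, ?_⟩, ?_⟩
  · intro i
    dsimp only
    split_ifs <;> simp
  · have : (Finset.univ.filter fun i => (if i ∈ T then (1 : ℤ) else if i ∈ R then -1 else 0) ≠ 0)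
        = T ∪ R := by
      ext i
      by_cases h1 : i ∈ T <;> by_cases h2 : i ∈ R <;> simp [h1, h2]
    rw [this, Finset.card_union_of_disjoint hTR]
    omega
  · rintro A hA hAC hAR ⟨i, hi, hAi⟩ ⟨j, hj, hAj⟩
    refine ⟨?_, fun h => ?_⟩
    · have h1 : ∀ k, A k * (if k ∈ T then 1 else if k ∈ R then -1 else 0) =
          (if k ∈ T then A k else 0) - (if k ∈ R then A k else 0) := by
        intro k
        by_cases h1 : k ∈ T
        · simp [h1, Finset.disjoint_left.1 hTR h1]
        · by_cases h2 : k ∈ R <;> simp [h1, h2]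
      simp_rw [h1, Finset.sum_sub_distrib, Finset.sum_ite_mem, Finset.univ_inter]
      rw [hsub hA (fun h => hAC (h.mono hTC)) (hPT hi) hAi, hsub hA hAR hj hAj, sub_self]
    · simpa [hAi, hPT hi] using h i

/-- The `j`-th interval of length `s` in `{0, …, L - 1}`, as a set of coordinates. -/
def interval (n L s j : ℕ) : Finset (Fin n) := {i | i.val < L ∧ i.val / s = j}

/-- The coordinates from `L` on. -/
def tail (n L : ℕ) : Finset (Fin n) := {i | L ≤ i.val}

theorem mem_interval {n L s j : ℕ} {i : Fin n} :
    i ∈ interval n L s j ↔ i.val < L ∧ i.val / s = j := by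
  simp [interval]

theorem mem_tail {n L : ℕ} {i : Fin n} : i ∈ tail n L ↔ L ≤ i.val := by
  simp [tail]

theorem card_interval_le (n L j : ℕ) {s : ℕ} (hs : 0 < s) : #(interval n L s j) ≤ s := by
  have h : #(interval n L s j) ≤ #(Finset.Ico (j * s) (j * s + s)) := by
    refine Finset.card_le_card_of_injOn Fin.val (fun i hi => ?_) Fin.val_injective.injOn
    have h := (mem_interval.1 hi).2
    rw [Nat.div_eq_iff hs] at h
    simp only [coe_Ico, Set.mem_Ico]
    omega
  simpa using h

theorem card_interval_eq {n L j s : ℕ} (hs : 0 < s) (hL : L ≤ n) (hj : (j + 1) * s ≤ L) :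
    #(interval n L s j) = s := by
  have h : (interval n L s j).map Fin.valEmbedding = Finset.Ico (j * s) (j * s + s) := by
    ext x
    simp only [mem_map, mem_interval, Fin.valEmbedding_apply, mem_Ico]
    constructor
    · rintro ⟨i, ⟨-, h⟩, rfl⟩
      rw [Nat.div_eq_iff hs] at h
      omega
    · rintro ⟨h1, h2⟩
      have : x < L := by nlinarith
      exact ⟨⟨x, by omega⟩, ⟨this, by rw [Nat.div_eq_iff hs]; dsimp only; omega⟩, rfl⟩
  rw [← Finset.card_map Fin.valEmbedding, h]
  simp

theorem card_tail (n L : ℕ) : #(tail n L) = n - L := by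
  have h : (tail n L).map Fin.valEmbedding = Finset.Ico L n := by
    ext x
    simp only [mem_map, mem_tail, Fin.valEmbedding_apply, mem_Ico]
    constructor
    · rintro ⟨i, h, rfl⟩
      exact ⟨h, i.2⟩
    · rintro ⟨h1, h2⟩
      exact ⟨⟨x, h2⟩, h1, rfl⟩
  rw [← Finset.card_map Fin.valEmbedding, h]
  simp

theorem disjoint_interval_tail (n L s j : ℕ) : Disjoint (interval n L s j) (tail n L) := by
  rw [Finset.disjoint_left]
  intro i hi hi'
  rw [mem_interval] at hi
  rw [mem_tail] at hi'
  omega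

theorem interval_subset_interval_two_mul (n L h a : ℕ) :
    interval n L h a ⊆ interval n L (2 * h) (a / 2) := by
  intro i hi
  rw [mem_interval] at hi ⊢
  refine ⟨hi.1, ?_⟩
  rw [mul_comm, ← Nat.div_div_eq_div_mul, hi.2]

theorem exists_two_of_not_trivialPt {n d : ℕ} {A : Fin n → ℤ} (hA : IsCubePt A)
    (h : ¬ TrivialPt d A) : ∃ i j, i ≠ j ∧ A i = 1 ∧ A j = 1 := by
  simp only [TrivialPt, not_or] at h
  obtain ⟨h0, h1, -⟩ := h
  push Not at h0
  obtain ⟨i, hi⟩ := h0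
  by_contra! hc
  refine h1 ⟨i, fun j => ?_⟩
  split_ifs with hj
  · rw [hj]; exact (hA i).resolve_left hi
  · exact (hA j).resolve_right (hc i j (Ne.symm hj) ((hA i).resolve_left hi))

/-- Pairs of parts in different blocks, where part `a` lies in block `a / 2`. -/
def separatedPairs (K : ℕ) : Finset (Σ _ : ℕ, ℕ) :=
  (Finset.range K).sigma fun b => Finset.range (2 * (b / 2))

theorem card_separatedPairs (K : ℕ) : #(separatedPairs K) + K / 2 = K.choose 2 := by
  unfold separatedPairs
  simp only [Finset.card_sigma, Finset.card_range]
  induction K with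
  | zero => rfl
  | succ K ih =>
    rw [Finset.sum_range_succ, Nat.choose_succ_succ' K 1, ← ih, Nat.choose_one_right]
    omega

/-- One vector for each pair of half-blocks from different blocks hits every point that has at
least two ones but at most one in each block. -/
theorem exists_separating_family {n d h L K : ℕ} (hh : 0 < h) (hL : L ≤ n)
    (hd : 2 * h + (n - L) = d) (hK : ∀ b, b < K ↔ b * h < L) :
    ∃ F : Finset (Fin n → ℤ), #F + K / 2 ≤ K.choose 2 ∧ (∀ V ∈ F, IsSignVec d V) ∧
      ∀ A, IsCubePt A → (∀ j, ¬ MeetsTwice A (interval n L (2 * h) j ∪ tail n L)) →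
        (∃ i j : Fin n, i ≠ j ∧ i.val < L ∧ j.val < L ∧ A i = 1 ∧ A j = 1) →
        ∃ V ∈ F, NonTrivOrth A V := by
  classical
  have key : ∀ p : Σ _ : ℕ, ℕ, ∃ V : Fin n → ℤ, p ∈ separatedPairs K → IsSignVec d V ∧
      ∀ A, IsCubePt A → (∀ j, ¬ MeetsTwice A (interval n L (2 * h) j ∪ tail n L)) →
        (∃ i ∈ interval n L h p.2, A i = 1) → (∃ j ∈ interval n L h p.1, A j = 1) →
        NonTrivOrth A V := by
    rintro ⟨b, a⟩
    by_cases hp : (⟨b, a⟩ : Σ _ : ℕ, ℕ) ∈ separatedPairs K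
    swap
    · exact ⟨0, fun hp' => absurd hp' hp⟩
    simp only [separatedPairs, mem_sigma, mem_range] at hp
    obtain ⟨hb, hab⟩ := hp
    have hfull : (a / 2 + 1) * (2 * h) ≤ L := by
      have h1 : (a / 2 + 1) * 2 ≤ b := by omega
      have h2 := (hK b).1 hb
      nlinarith
    have hdisj : Disjoint (interval n L (2 * h) (a / 2) ∪ tail n L) (interval n L h b) := by
      refine Finset.disjoint_union_left.2 ⟨?_, (disjoint_interval_tail n L h b).symm⟩
      rw [Finset.disjoint_left]
      intro i hi hi'
      have h1 := (mem_interval.1 hi).2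
      have h2 := (mem_interval.1 (interval_subset_interval_two_mul _ _ _ _ hi')).2
      omega
    obtain ⟨V, hV, hVA⟩ := exists_separating_vector (d := d)
      ((interval_subset_interval_two_mul n L h a).trans Finset.subset_union_left)
      (by rw [Finset.card_union_of_disjoint (disjoint_interval_tail _ _ _ _), card_tail,
            card_interval_eq (by omega) hL hfull, hd]) hdisj
      (by
        have := card_interval_le n L a hh
        have := card_interval_le n L b hh
        omega)
    refine ⟨V, fun _ => ⟨hV, fun A hA hA2 => hVA A hA (hA2 _) fun hm => hA2 (b / 2) ?_⟩⟩
    exact hm.mono ((interval_subset_interval_two_mul n L h b).trans Finset.subset_union_left)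
  choose V hV using key
  refine ⟨(separatedPairs K).image V, ?_, ?_, ?_⟩
  · have := card_separatedPairs K
    have := Finset.card_image_le (s := separatedPairs K) (f := V)
    omega
  · intro W hW
    obtain ⟨p, hp, rfl⟩ := Finset.mem_image.1 hW
    exact (hV p hp).1
  · intro A hA hA2 hij
    have hlt : ∃ i j : Fin n, i.val / h < 2 * (j.val / h / 2) ∧ i.val < L ∧ j.val < L ∧
        A i = 1 ∧ A j = 1 := by
      obtain ⟨i, j, hne, hi, hj, hAi, hAj⟩ := hij
      have hblock : i.val / h / 2 ≠ j.val / h / 2 := by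
        intro heq
        rw [Nat.div_div_eq_div_mul, Nat.div_div_eq_div_mul, mul_comm h 2] at heq
        exact hA2 _ ⟨i, Finset.mem_union_left _ (mem_interval.2 ⟨hi, rfl⟩),
          j, Finset.mem_union_left _ (mem_interval.2 ⟨hj, heq.symm⟩), hne, hAi, hAj⟩
      rcases lt_or_gt_of_ne hblock with h1 | h1
      · exact ⟨i, j, by omega, hi, hj, hAi, hAj⟩
      · exact ⟨j, i, by omega, hj, hi, hAj, hAi⟩
    obtain ⟨i, j, hlt, hi, hj, hAi, hAj⟩ := hlt
    have hp : (⟨j.val / h, i.val / h⟩ : Σ _ : ℕ, ℕ) ∈ separatedPairs K := by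
      simp only [separatedPairs, mem_sigma, mem_range]
      exact ⟨(hK _).2 ((Nat.div_mul_le_self _ _).trans_lt hj), hlt⟩
    exact ⟨_, Finset.mem_image_of_mem V hp, (hV _ hp).2 A hA hA2
      ⟨i, mem_interval.2 ⟨hi, rfl⟩, hAi⟩ ⟨j, mem_interval.2 ⟨hj, rfl⟩, hAj⟩⟩

theorem exists_covering_of_odd {n h K : ℕ} (hh : 0 < h) (hn : 2 * h + 1 < n)
    (hK : ∀ b, b < K ↔ b * h < n - 1) :
    ∃ F : Finset (Fin n → ℤ), IsCovering n (2 * h + 1) F ∧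
      #F ≤ K.choose 2 + (K + 1) / 2 * (2 * h + 1) := by
  classical
  obtain ⟨F, hFc, hF, hFA⟩ := exists_separating_family (n := n) (d := 2 * h + 1) (L := n - 1) hh
    (by omega) (by omega) hK
  set N := (K + 1) / 2
  let B : ℕ → Finset (Fin n) := fun j => interval n (n - 1) (2 * h) j ∪ tail n (n - 1)
  let o : Fin n := ⟨n - 1, by omega⟩
  have htail : ∀ i : Fin n, i ∈ tail n (n - 1) ↔ i = o := by
    intro i
    rw [mem_tail, Fin.ext_iff]
    have := i.2
    simp only [o]
    omega
  have hoB : ∀ j, o ∈ B j := fun j => Finset.mem_union_right _ ((htail o).2 rfl)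
  have hBcard : ∀ j, #(B j) ≤ 2 * h + 1 := by
    intro j
    have h1 := card_interval_le n (n - 1) j (s := 2 * h) (by omega)
    have h2 := card_tail n (n - 1)
    have h3 := Finset.card_union_le (interval n (n - 1) (2 * h) j) (tail n (n - 1))
    simp only [B]
    omega
  have hC : ∀ j, ∃ C, B j ⊆ C ∧ #C = 2 * h + 1 := fun j =>
    Finset.exists_superset_card_eq (hBcard j) (by simp; omega)
  choose C hBC hCcard using hC
  have hfull : ∀ j, (j + 1) * (2 * h) ≤ n - 1 → C j = B j := by
    intro j hj
    refine (Finset.eq_of_subset_of_card_le (hBC j) ?_).symm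
    rw [hCcard, Finset.card_union_of_disjoint (disjoint_interval_tail _ _ _ _), card_tail,
      card_interval_eq (by omega) (by omega) hj]
    omega
  have hlt_ne : ∀ i j, i < j → j < N → C i ≠ C j := by
    intro i j hij hj heq
    have h1 : j * 2 * h < n - 1 := (hK _).1 (by omega)
    have h2 : (i + 1) * (2 * h) ≤ n - 1 := by nlinarith
    let x : Fin n := ⟨j * (2 * h), by rw [← mul_assoc]; omega⟩
    have hx : x.val < n - 1 := by simp only [x]; rw [← mul_assoc]; exact h1
    have hxj : x ∈ C j := hBC j (Finset.mem_union_left _ (mem_interval.2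
      ⟨hx, Nat.mul_div_cancel _ (by omega)⟩))
    rw [← heq, hfull i h2] at hxj
    rcases Finset.mem_union.1 hxj with hxi | hxi
    · have h3 := (mem_interval.1 hxi).2
      simp only [x, Nat.mul_div_cancel _ (show 0 < 2 * h by omega)] at h3
      omega
    · have := mem_tail.1 hxi
      omega
  have hN2 : 2 ≤ N := by
    have : 2 < K := (hK 2).2 (by omega)
    omega
  have hnext : ∀ j, ∃ x, x ∈ C ((j + 1) % N) ∧ x ∉ C (j % N) := by
    intro j
    have h1 : (j + 1) % N < N := Nat.mod_lt _ (by omega)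
    have h2 : j % N < N := Nat.mod_lt _ (by omega)
    have h3 : (j + 1) % N ≠ j % N := by
      intro heq
      have h4 : j + 1 ≡ j + 0 [MOD N] := heq
      have h5 := Nat.ModEq.add_left_cancel' j h4
      have h6 := (Nat.modEq_zero_iff_dvd.1 h5)
      have := Nat.le_of_dvd one_pos h6
      omega
    have h4 : C ((j + 1) % N) ≠ C (j % N) := by
      rcases lt_or_gt_of_ne h3 with h | h
      · exact hlt_ne _ _ h h2
      · exact (hlt_ne _ _ h h1).symm
    by_contra! hsub
    exact h4 (Finset.eq_of_subset_of_card_le hsub (by rw [hCcard, hCcard]))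
  choose x hxC hxC' using hnext
  have hG : ∀ j, ∃ G : Finset (Fin n → ℤ), #G ≤ 2 * h + 1 ∧ (∀ V ∈ G, IsSignVec (2 * h + 1) V) ∧
      ∀ A, IsCubePt A → MeetsTwice A (C (j % N)) →
        (A (x j) = 0 ∨ ∃ i ∈ C (j % N), A i = 0) → ∃ V ∈ G, NonTrivOrth A V := by
    intro j
    obtain ⟨G, hG, hG', hGA⟩ := exists_rotation_family (d := 2 * h + 1) (C (j % N))
      (fun i => if i = x j then 1 else 0) (hCcard _) ⟨h, rfl⟩
      (fun i => by by_cases hi : i = x j <;> simp [hi])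
      (fun i hi => if_neg fun (he : i = x j) => hxC' j (he ▸ hi))
      (by simp [Finset.filter_eq']; omega)
    refine ⟨G, hG, hG', fun A hA h2 hz => hGA A hA h2 ?_⟩
    simp only [mul_ite, mul_one, mul_zero, Finset.sum_ite_eq', Finset.mem_univ, if_true]
    have := hA (x j)
    tauto
  choose G hGcard hGsign hGA using hG
  refine ⟨F ∪ (Finset.range N).biUnion G, ⟨?_, ?_⟩, ?_⟩
  · intro V hV
    rcases Finset.mem_union.1 hV with hV | hV
    · exact hF V hV
    · obtain ⟨j, -, hj⟩ := Finset.mem_biUnion.1 hV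
      exact hGsign j V hj
  · intro A hA hAt
    have hcover : ∀ i : Fin n, i ≠ o → ∃ j < N, i ∈ B j := by
      intro i hi
      have h1 : i.val < n - 1 := by
        by_contra hc
        exact hi ((htail i).1 (mem_tail.2 (by omega)))
      refine ⟨i.val / (2 * h), ?_, Finset.mem_union_left _ (mem_interval.2 ⟨h1, rfl⟩)⟩
      have h2 : i.val / h < K := (hK _).2 ((Nat.div_mul_le_self _ _).trans_lt h1)
      rw [mul_comm, ← Nat.div_div_eq_div_mul]
      omega
    by_contra hno
    have hmiss : ∀ j < N, MeetsTwice A (C j) → A (x j) = 1 ∧ ∀ i ∈ C j, A i = 1 := by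
      intro j hj h2
      by_contra hc
      have hz : A (x j) = 0 ∨ ∃ i ∈ C (j % N), A i = 0 := by
        rw [Nat.mod_eq_of_lt hj]
        by_contra! hc'
        exact hc ⟨(hA _).resolve_left hc'.1, fun i hi => (hA i).resolve_left (hc'.2 i hi)⟩
      obtain ⟨V, hV, hVA⟩ := hGA j A hA (by rwa [Nat.mod_eq_of_lt hj]) hz
      exact hno ⟨V, Finset.mem_union_right _ (Finset.mem_biUnion.2 ⟨j, Finset.mem_range.2 hj, hV⟩),
        hVA⟩
    have hstep : ∀ j < N, MeetsTwice A (C j) → MeetsTwice A (C ((j + 1) % N)) := by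
      intro j hj h2
      obtain ⟨h3, h4⟩ := hmiss j hj h2
      refine ⟨x j, hxC j, o, hBC _ (hoB _), ?_, h3, h4 o (hBC _ (hoB _))⟩
      intro he
      exact hxC' j (he ▸ hBC _ (hoB _))
    by_cases htwo : ∃ j < N, MeetsTwice A (C j)
    · obtain ⟨j, hj, h2⟩ := htwo
      have hall : ∀ k, MeetsTwice A (C ((j + k) % N)) := by
        intro k
        induction k with
        | zero => rwa [add_zero, Nat.mod_eq_of_lt hj]
        | succ k ih =>
          have := hstep _ (Nat.mod_lt _ (by omega)) ih
          rwa [Nat.mod_add_mod] at this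
      have hone : ∀ i < N, ∀ y ∈ C i, A y = 1 := by
        intro i hi
        have h3 := hall (N - j + i)
        rw [show j + (N - j + i) = i + N by omega, Nat.add_mod_right, Nat.mod_eq_of_lt hi] at h3
        exact (hmiss i hi h3).2
      refine hAt (Or.inr (Or.inr ⟨⟨h, rfl⟩, fun i => ?_⟩))
      by_cases hi : i = o
      · exact hone 0 (by omega) i (hi ▸ hBC _ (hoB _))
      · obtain ⟨k, hk, hik⟩ := hcover i hi
        exact hone k hk i (hBC k hik)
    · push Not at htwo
      have hB : ∀ j, ¬ MeetsTwice A (B j) := by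
        intro j h2
        by_cases hj : j < N
        · exact htwo j hj (h2.mono (hBC j))
        · obtain ⟨a, ha, b, hb, hab, -⟩ := h2
          have hempty : ∀ y ∈ B j, y = o := by
            intro y hy
            rcases Finset.mem_union.1 hy with h3 | h3
            · obtain ⟨h4, h5⟩ := mem_interval.1 h3
              have h6 : y.val / h < K := (hK _).2 ((Nat.div_mul_le_self _ _).trans_lt h4)
              rw [mul_comm, ← Nat.div_div_eq_div_mul] at h5
              omega
            · exact (htail y).1 h3
          exact hab ((hempty a ha).trans (hempty b hb).symm)
      obtain ⟨i, j, hij, hi, hj⟩ := exists_two_of_not_trivialPt hA hAt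
      have hne : ∀ i j, i ≠ j → A i = 1 → A j = 1 → i ≠ o := by
        rintro i j hij hi hj rfl
        obtain ⟨k, -, hjk⟩ := hcover j hij.symm
        exact hB k ⟨_, hoB k, j, hjk, hij, hi, hj⟩
      have hlt : ∀ i, i ≠ o → i.val < n - 1 := by
        intro i hi
        by_contra hc
        exact hi ((htail i).1 (mem_tail.2 (by omega)))
      obtain ⟨V, hV, hVA⟩ := hFA A hA hB ⟨i, j, hij, hlt i (hne i j hij hi hj),
        hlt j (hne j i hij.symm hj hi), hi, hj⟩
      exact hno ⟨V, Finset.mem_union_left _ hV, hVA⟩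
  · have h1 := Finset.card_union_le F ((Finset.range N).biUnion G)
    have h2 := Finset.card_biUnion_le_card_mul (Finset.range N) G (2 * h + 1) fun j _ => hGcard j
    rw [Finset.card_range] at h2
    omega

theorem exists_covering_of_even {n h K : ℕ} (hh : 0 < h) (hn : 2 * h < n)
    (hK : ∀ b, b < K ↔ b * h < n) :
    ∃ F : Finset (Fin n → ℤ), IsCovering n (2 * h) F ∧
      #F ≤ K.choose 2 + (K + 1) / 2 * (2 * h) := by
  classical
  obtain ⟨F, hFc, hF, hFA⟩ := exists_separating_family (n := n) (d := 2 * h) (L := n) hh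
    le_rfl (by omega) hK
  let B : ℕ → Finset (Fin n) := interval n n (2 * h)
  have hG : ∀ j, ∃ G : Finset (Fin n → ℤ), #G ≤ 2 * h + 1 ∧ (∀ V ∈ G, IsSignVec (2 * h) V) ∧
      ∀ A, IsCubePt A → MeetsTwice A (B j) → ∃ V ∈ G, NonTrivOrth A V := by
    intro j
    obtain ⟨C, hBC, hC⟩ := Finset.exists_superset_card_eq (n := 2 * h + 1)
      ((card_interval_le n n j (s := 2 * h) (by omega)).trans (Nat.le_succ _)) (by simp; omega)
    obtain ⟨G, hG, hG', hGA⟩ := exists_rotation_family (d := 2 * h) C 0 hC ⟨h, rfl⟩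
      (by simp) (by simp) (by simp)
    exact ⟨G, hG, hG', fun A hA h2 => hGA A hA (h2.mono hBC) (Or.inl (by simp))⟩
  choose G hGcard hGsign hGA using hG
  have hK3 : 2 < K := (hK 2).2 hn
  obtain ⟨E, hEcard, hEsign, hEA⟩ : ∃ E : Finset (Fin n → ℤ), #E ≤ K % 2 * (2 * h) ∧
      (∀ V ∈ E, IsSignVec (2 * h) V) ∧ ∀ A, IsCubePt A → K % 2 = 1 →
        MeetsTwice A (B (K / 2)) → ¬ MeetsTwice A (B 0) → ∃ V ∈ E, NonTrivOrth A V := by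
    by_cases hodd : K % 2 = 1
    swap
    · exact ⟨∅, by simp, by simp, fun _ _ h => absurd h hodd⟩
    have hlast : #(B (K / 2)) ≤ h := by
      refine (Finset.card_le_card fun i hi => ?_).trans (card_interval_le n n (K - 1) hh)
      obtain ⟨hi1, hi2⟩ := mem_interval.1 hi
      refine mem_interval.2 ⟨hi1, ?_⟩
      have h1 : i.val / h < K := (hK _).2 ((Nat.div_mul_le_self _ _).trans_lt hi1)
      rw [mul_comm, ← Nat.div_div_eq_div_mul] at hi2
      omega
    by_cases hsmall : #(B (K / 2)) ≤ 1
    · refine ⟨∅, by simp, by simp, fun A _ _ h2 => ?_⟩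
      obtain ⟨i, hi, j, hj, hij, -⟩ := h2
      exact absurd (Finset.card_le_one.1 hsmall i hi j hj) hij
    have h0card : #(B 0) = 2 * h := card_interval_eq (by omega) le_rfl (by omega)
    have hdisj : Disjoint (B (K / 2)) (B 0) := by
      rw [Finset.disjoint_left]
      intro i hi hi'
      have h1 := (mem_interval.1 hi).2
      have h2 := (mem_interval.1 hi').2
      omega
    obtain ⟨Y, hY, hYcard⟩ := Finset.exists_subset_card_eq (s := B 0)
      (n := 2 * h - 1 - #(B (K / 2))) (by omega)
    obtain ⟨z, hz⟩ : Y.Nonempty := Finset.card_pos.1 (by omega)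
    obtain ⟨x, hx, y, hy, hxy⟩ := Finset.one_lt_card.1
      (show 1 < #(B 0 \ Y) by rw [Finset.card_sdiff_of_subset hY]; omega)
    rw [Finset.mem_sdiff] at hx hy
    have hnot : ∀ w, w ∈ B 0 → w ∉ Y → w ∉ B (K / 2) ∪ Y := by
      intro w hw hwY hw'
      rcases Finset.mem_union.1 hw' with h | h
      · exact Finset.disjoint_left.1 hdisj h hw
      · exact hwY h
    have hQ : #(B (K / 2) ∪ Y) = 2 * h - 1 := by
      rw [Finset.card_union_of_disjoint (hdisj.mono_right hY)]
      omega
    obtain ⟨E, hE, hE', hEA⟩ := exists_rotation_family (d := 2 * h) (B (K / 2) ∪ Y)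
      (fun i => (if i = x then 1 else 0) - (if i = y then 1 else 0)) hQ ⟨h - 1, by omega⟩
      (fun i => by
        by_cases h1 : i = x
        · simp [h1, hxy]
        · by_cases h2 : i = y <;> simp [h1, h2, hxy.symm])
      (fun i hi => by
        have h1 : i ≠ x := fun he => hnot x hx.1 hx.2 (he ▸ hi)
        have h2 : i ≠ y := fun he => hnot y hy.1 hy.2 (he ▸ hi)
        simp [h1, h2])
      (by
        have : (Finset.univ.filter fun i =>
            ((if i = x then (1 : ℤ) else 0) - (if i = y then 1 else 0)) ≠ 0) = {x, y} := by
          ext i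
          by_cases h1 : i = x
          · subst h1; simp [hxy]
          · by_cases h2 : i = y <;> simp [h1, h2, hxy.symm]
        rw [this, Finset.card_pair hxy]
        omega)
    refine ⟨E, by rw [hodd]; omega, hE', fun A hA _ h2 h0 =>
      hEA A hA (h2.mono Finset.subset_union_left) ?_⟩
    simp only [mul_sub, mul_ite, mul_one, mul_zero, Finset.sum_sub_distrib, Finset.sum_ite_eq',
      Finset.mem_univ, if_true]
    by_cases hAz : A z = 0
    · have := hA x
      have := hA y
      have hz' : ∃ i ∈ B (K / 2) ∪ Y, A i = 0 := ⟨z, Finset.mem_union_right _ hz, hAz⟩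
      simp only [hz', and_true]
      omega
    · have hzero : ∀ w, w ∈ B 0 → w ∉ Y → A w = 0 := by
        intro w hw hwY
        by_contra hAw
        exact h0 ⟨z, hY hz, w, hw, fun he => hwY (he ▸ hz), (hA z).resolve_left hAz,
          (hA w).resolve_left hAw⟩
      left
      rw [hzero x hx.1 hx.2, hzero y hy.1 hy.2, sub_zero]
  refine ⟨F ∪ ((Finset.range (K / 2)).biUnion G ∪ E), ⟨?_, ?_⟩, ?_⟩
  · intro V hV
    rcases Finset.mem_union.1 hV with hV | hV
    · exact hF V hV
    rcases Finset.mem_union.1 hV with hV | hV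
    · obtain ⟨j, -, hj⟩ := Finset.mem_biUnion.1 hV
      exact hGsign j V hj
    · exact hEsign V hV
  · intro A hA hAt
    by_contra hno
    have hfull : ∀ j < K / 2, ¬ MeetsTwice A (B j) := by
      intro j hj h2
      obtain ⟨V, hV, hVA⟩ := hGA j A hA h2
      exact hno ⟨V, Finset.mem_union_right _ (Finset.mem_union_left _
        (Finset.mem_biUnion.2 ⟨j, Finset.mem_range.2 hj, hV⟩)), hVA⟩
    have hB : ∀ j, ¬ MeetsTwice A (B j) := by
      intro j h2
      have hj : 2 * j < K := by
        obtain ⟨i, hi, -⟩ := h2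
        obtain ⟨h4, h5⟩ := mem_interval.1 hi
        have h6 : i.val / h < K := (hK _).2 ((Nat.div_mul_le_self _ _).trans_lt h4)
        rw [mul_comm, ← Nat.div_div_eq_div_mul] at h5
        omega
      by_cases hj' : j < K / 2
      · exact hfull j hj' h2
      · obtain rfl : j = K / 2 := by omega
        obtain ⟨V, hV, hVA⟩ := hEA A hA (by omega) h2 (hfull 0 (by omega))
        exact hno ⟨V, Finset.mem_union_right _ (Finset.mem_union_right _ hV), hVA⟩
    obtain ⟨i, j, hij, hi, hj⟩ := exists_two_of_not_trivialPt hA hAt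
    have htail : tail n n = ∅ := Finset.card_eq_zero.1 (by rw [card_tail, Nat.sub_self])
    obtain ⟨V, hV, hVA⟩ := hFA A hA (by simpa only [htail, Finset.union_empty] using hB)
      ⟨i, j, hij, i.2, j.2, hi, hj⟩
    exact hno ⟨V, Finset.mem_union_left _ hV, hVA⟩
  · have h1 := Finset.card_union_le F ((Finset.range (K / 2)).biUnion G ∪ E)
    have h2 := Finset.card_union_le ((Finset.range (K / 2)).biUnion G) E
    have h3 := Finset.card_biUnion_le_card_mul (Finset.range (K / 2)) G (2 * h + 1)
      fun j _ => hGcard j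
    rw [Finset.card_range] at h3
    have h4 : (K + 1) / 2 = K / 2 + K % 2 := by omega
    rw [h4, add_mul]
    rw [mul_add, mul_one] at h3
    omega

theorem beta_le_of_isCovering {n d : ℕ} {F : Finset (Fin n → ℤ)} (h : IsCovering n d F) :
    beta n d ≤ #F :=
  Nat.sInf_le ⟨F, rfl, h⟩

/-- A sign vector of full support is not orthogonal to a point with three ones, so there is no
covering with `d = n ≥ 4`. -/
theorem beta_self_of_four_le {n : ℕ} (hn : 4 ≤ n) : beta n n = 0 := by
  classical
  refine Nat.sInf_eq_zero.2 (Or.inr (Set.eq_empty_iff_forall_notMem.2 ?_))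
  rintro t ⟨F, -, hF, hFA⟩
  let A : Fin n → ℤ := fun i => if i.val < 3 then 1 else 0
  obtain ⟨V, hV, hVA, -⟩ := hFA A (fun i => by by_cases h : i.val < 3 <;> simp [A, h]) (by
    rintro (h | ⟨j, h⟩ | ⟨-, h⟩)
    · simpa [A] using h ⟨0, by omega⟩
    · have h0 := h ⟨0, by omega⟩
      have h1 := h ⟨1, by omega⟩
      simp only [A] at h0 h1
      have e0 : (⟨0, by omega⟩ : Fin n) = j := by by_contra hc; simp [hc] at h0
      have e1 : (⟨1, by omega⟩ : Fin n) = j := by by_contra hc; simp [hc] at h1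
      simpa using e0.trans e1.symm
    · simpa [A] using h ⟨3, by omega⟩)
  obtain ⟨m, rfl⟩ : ∃ m, n = m + 4 := ⟨n - 4, by omega⟩
  obtain ⟨hV1, hV2⟩ := hF V hV
  have hne : ∀ i, V i ≠ 0 := by
    have h1 := (Finset.card_eq_iff_eq_univ _).1 (hV2.trans (Fintype.card_fin _).symm)
    intro i
    have := Finset.mem_univ i
    rw [← h1] at this
    exact (Finset.mem_filter.1 this).2
  rw [Fin.sum_univ_succ, Fin.sum_univ_succ, Fin.sum_univ_succ, Finset.sum_eq_zero] at hVA
  · simp only [A, Fin.val_zero, Fin.val_succ] at hVA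
    norm_num at hVA
    have h0 := hV1 0
    have h1 := hV1 (Fin.succ 0)
    have h2 := hV1 (Fin.succ (Fin.succ 0))
    have n0 := hne 0
    have n1 := hne (Fin.succ 0)
    have n2 := hne (Fin.succ (Fin.succ 0))
    simp only [Fin.succ_zero_eq_one, Fin.succ_one_eq_two] at *
    omega
  · intro i _
    simp [A]

theorem beta_two_two : beta 2 2 ≤ 3 := by
  refine (beta_le_of_isCovering (F := {![1, -1]}) ⟨?_, ?_⟩).trans (by simp)
  · simp only [Finset.mem_singleton, forall_eq]
    refine ⟨?_, by decide⟩
    intro i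
    fin_cases i <;> simp
  · intro A hA hAt
    refine ⟨_, Finset.mem_singleton_self _, ?_⟩
    obtain ⟨i, j, hij, hi, hj⟩ := exists_two_of_not_trivialPt hA hAt
    have h01 : A 0 = 1 ∧ A 1 = 1 := by
      fin_cases i <;> fin_cases j <;> simp_all
    refine ⟨by simp [Fin.sum_univ_two, h01], fun h => ?_⟩
    simpa [h01] using h 0

theorem beta_three_three : beta 3 3 ≤ 4 := by
  refine (beta_le_of_isCovering (F := {![1, -1, 1], ![1, 1, -1]}) ⟨?_, ?_⟩).trans
    (Finset.card_le_two.trans (by norm_num))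
  · simp only [Finset.mem_insert, Finset.mem_singleton, forall_eq_or_imp, forall_eq]
    refine ⟨⟨?_, by decide⟩, ⟨?_, by decide⟩⟩ <;>
    · intro i
      fin_cases i <;> simp
  · intro A hA hAt
    obtain ⟨i, j, hij, hi, hj⟩ := exists_two_of_not_trivialPt hA hAt
    have hall : ¬ (A 0 = 1 ∧ A 1 = 1 ∧ A 2 = 1) := by
      rintro ⟨h0, h1, h2⟩
      refine hAt (Or.inr (Or.inr ⟨⟨1, rfl⟩, fun i => ?_⟩))
      fin_cases i <;> assumption
    have h0 := hA 0
    have h1 := hA 1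
    have h2 := hA 2
    have hcase : (A 0 = 1 ∧ A 1 = 1 ∧ A 2 = 0) ∨ (A 0 = 0 ∧ A 1 = 1 ∧ A 2 = 1) ∨
        (A 0 = 1 ∧ A 1 = 0 ∧ A 2 = 1) := by
      fin_cases i <;> fin_cases j <;> simp_all
    simp only [Finset.mem_insert, Finset.mem_singleton, exists_eq_or_imp, exists_eq_left,
      NonTrivOrth, TrivOrth, Fin.sum_univ_three, Fin.forall_fin_succ]
    rcases hcase with ⟨e0, e1, e2⟩ | ⟨e0, e1, e2⟩ | ⟨e0, e1, e2⟩ <;> simp [e0, e1, e2]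

/-- For `2 ≤ d ≤ n`,
`β^d(n) ≤ C(⌈2(n-1)/(d-1)⌉, 2) + ⌈(n-1)/(d-1)⌉·d`. -/
theorem beta_upper_bound_improved (n d : ℕ) (hd : 2 ≤ d) (hdn : d ≤ n) :
    beta n d ≤
      Nat.choose ⌈(2 * ((n : ℚ) - 1)) / ((d : ℚ) - 1)⌉₊ 2 +
        ⌈((n : ℚ) - 1) / ((d : ℚ) - 1)⌉₊ * d := by
  have hd' : (0 : ℚ) < (d : ℚ) - 1 := by
    have : (2 : ℚ) ≤ d := by exact_mod_cast hd
    linarith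
  obtain ⟨e, rfl⟩ : ∃ e, d = e + 1 := ⟨d - 1, by omega⟩
  obtain ⟨k, rfl⟩ : ∃ k, n = k + 1 := ⟨n - 1, by omega⟩
  have hM : 2 * k ≤ ⌈(2 * (((k + 1 : ℕ) : ℚ) - 1)) / (((e + 1 : ℕ) : ℚ) - 1)⌉₊ * e := by
    have h := Nat.le_ceil ((2 * (((k + 1 : ℕ) : ℚ) - 1)) / (((e + 1 : ℕ) : ℚ) - 1))
    rw [div_le_iff₀ hd'] at h
    push_cast at h
    simp only [add_sub_cancel_right] at h
    push_cast
    simp only [add_sub_cancel_right]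
    exact_mod_cast h
  have hN : k ≤ ⌈(((k + 1 : ℕ) : ℚ) - 1) / (((e + 1 : ℕ) : ℚ) - 1)⌉₊ * e := by
    have h := Nat.le_ceil ((((k + 1 : ℕ) : ℚ) - 1) / (((e + 1 : ℕ) : ℚ) - 1))
    rw [div_le_iff₀ hd'] at h
    push_cast at h
    simp only [add_sub_cancel_right] at h
    push_cast
    simp only [add_sub_cancel_right]
    exact_mod_cast h
  generalize ⌈(2 * (((k + 1 : ℕ) : ℚ) - 1)) / (((e + 1 : ℕ) : ℚ) - 1)⌉₊ = M at hM ⊢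
  generalize ⌈(((k + 1 : ℕ) : ℚ) - 1) / (((e + 1 : ℕ) : ℚ) - 1)⌉₊ = N at hN ⊢
  have hM2 : 2 ≤ M := by
    by_contra hc
    have : M ≤ 1 := by omega
    nlinarith
  have hN1 : 1 ≤ N := by
    by_contra hc
    have : N = 0 := by omega
    subst this
    omega
  have hbound : ∀ {K : ℕ}, K ≤ M → K ≤ 2 * N →
      K.choose 2 + (K + 1) / 2 * (e + 1) ≤ M.choose 2 + N * (e + 1) := fun h1 h2 =>
    add_le_add (Nat.choose_le_choose 2 h1) (Nat.mul_le_mul_right _ (by omega))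
  have hceil : ∀ {h : ℕ} (L : ℕ), 0 < h → ∀ b, b < (L + h - 1) / h ↔ b * h < L := by
    intro h L hh b
    rw [Nat.lt_iff_add_one_le, Nat.le_div_iff_mul_le hh, add_mul]
    omega
  rcases Nat.lt_or_ge e k with hek | hek
  · rcases Nat.even_or_odd' e with ⟨h, rfl | rfl⟩
    · have hh : 0 < h := by omega
      obtain ⟨F, hF, hFc⟩ := exists_covering_of_odd (n := k + 1) hh (by omega) (hceil k hh)
      refine (beta_le_of_isCovering hF).trans (hFc.trans (hbound ?_ ?_))
      · by_contra! hc
        have := (hceil k hh _).1 hc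
        nlinarith
      · by_contra! hc
        have := (hceil k hh _).1 hc
        nlinarith
    · have hh : 0 < h + 1 := by omega
      obtain ⟨F, hF, hFc⟩ := exists_covering_of_even (n := k + 1) hh (by omega)
        (hceil (k + 1) hh)
      refine (beta_le_of_isCovering hF).trans (hFc.trans (hbound ?_ ?_))
      · by_contra! hc
        have := (hceil (k + 1) hh _).1 hc
        nlinarith
      · by_contra! hc
        have := (hceil (k + 1) hh _).1 hc
        nlinarith
  · obtain rfl : e = k := by omega
    have h1 : 1 + (e + 1) ≤ M.choose 2 + N * (e + 1) :=
      add_le_add (Nat.choose_pos hM2) (Nat.le_mul_of_pos_left _ hN1)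
    rcases Nat.lt_or_ge e 3 with h3 | h3
    · obtain rfl | rfl : e = 1 ∨ e = 2 := by omega
      · exact beta_two_two.trans (by omega)
      · exact beta_three_three.trans (by omega)
    · rw [beta_self_of_four_le (by omega)]
      exact Nat.zero_le _
end
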